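/- Fix integers n ≥ 2, k ≥ 1, N ≥ 1, and distinct points x̂₁, …, x̂_N ∈ ℂⁿ, let Y denote the set of tuples ((y_i)_{i=1}^N, (A_{i,j})_{1≤i≤N, 1≤j≤k}) where y_i ∈ ℂⁿ are pairwise distinct and each A_{i,j} : (ℂⁿ)^j → ℂⁿ is a symmetric continuous j-multilinear map with A_{i,1} invertible, regarded as a subset of the corresponding finite-dimensional normed space with its subspace topology. Let W = ℂ \ {0} and let γ = ((y_i), (A_{i,j})) : W → Y be a map whose components are holomorphic on W and which is null-homotopic, i.e. homotopic within Y, through continuous maps, to a constant map. Then there exists a holomorphic map F : W × ℂⁿ → ℂⁿ such that for every w ∈ W the map F(w, ·) is a holomorphic automorphism of ℂⁿ, and for all i and w: F(w, x̂_i) = y_i(w) and the j-th iterated Fréchet derivative of z ↦ F(w, z) at x̂_i equals A_{i,j}(w) for every 1 ≤ j ≤ k. -/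

import Mathlib

/-- The ambient space of `N`-tuples of `k`-jets at fixed base points in `ℂⁿ`:
images `yᵢ ∈ ℂⁿ` together with, for each `i` and each degree `j+1` (`j : Fin k`,
so degrees `1,…,k`), a continuous multilinear map `(ℂⁿ)^{j+1} → ℂⁿ`. -/
abbrev JetTupleSpace (n k N : ℕ) : Type :=
  (Fin N → EuclideanSpace ℂ (Fin n)) ×
  (Fin N → (j : Fin k) → ContinuousMultilinearMap ℂ
    (fun _ : Fin (j.1 + 1) => EuclideanSpace ℂ (Fin n)) (EuclideanSpace ℂ (Fin n)))

/-- The subset `Y` of nondegenerate `k`-jet tuples: the images are pairwise distinct,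
each multilinear map is symmetric, and the linear part (degree `1`, i.e. `j.1 = 0`)
is invertible. -/
def JetSet (n k N : ℕ) : Set (JetTupleSpace n k N) :=
  {p | (∀ i i', i ≠ i' → p.1 i ≠ p.1 i') ∧
       (∀ i (j : Fin k) (σ : Equiv.Perm (Fin (j.1 + 1)))
          (v : Fin (j.1 + 1) → EuclideanSpace ℂ (Fin n)), p.2 i j (v ∘ σ) = p.2 i j v) ∧
       (∀ i (j : Fin k), j.1 = 0 → Function.Bijective
         (fun v : EuclideanSpace ℂ (Fin n) => p.2 i j (fun _ => v)))}

namespace JetInterpolation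

open Filter Topology Set

/-- A holomorphic function on a disc is uniformly approximated by entire functions on
smaller discs. -/
theorem exists_entire_approx {ψ : ℂ → ℂ} {r R : ℝ} (hr : 0 ≤ r) (hrR : r < R)
    (hψ : DifferentiableOn ℂ ψ (Metric.ball 0 R)) {ε : ℝ} (hε : 0 < ε) :
    ∃ q : ℂ → ℂ, Differentiable ℂ q ∧ ∀ w, ‖w‖ ≤ r → ‖ψ w - q w‖ ≤ ε := by
  obtain ⟨R₁, h1, h2⟩ := exists_between hrR
  obtain ⟨r₁, h3, h4⟩ := exists_between h1
  lift R₁ to NNReal using (by linarith)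
  lift r₁ to NNReal using (by linarith)
  have hps := DifferentiableOn.hasFPowerSeriesOnBall (c := 0) (R := R₁) (f := ψ)
    (hψ.mono (Metric.closedBall_subset_ball h2)) (by
      rw [← NNReal.coe_pos]; linarith)
  have hu := hps.tendstoUniformlyOn' (r' := r₁) (by exact_mod_cast h4)
  rw [Metric.tendstoUniformlyOn_iff] at hu
  obtain ⟨m, hm⟩ := (hu ε hε).exists
  refine ⟨fun y => (cauchyPowerSeries ψ 0 R₁).partialSum m (y - 0), ?_, fun w hw => ?_⟩
  · unfold FormalMultilinearSeries.partialSum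
    refine Differentiable.fun_sum fun i _ => ?_
    have : ∀ y : ℂ, (cauchyPowerSeries ψ 0 R₁ i) (fun _ => y - 0)
        = y ^ i • (cauchyPowerSeries ψ 0 R₁).coeff i := by
      intro y
      rw [FormalMultilinearSeries.apply_eq_pow_smul_coeff, sub_zero]
    simp_rw [this]
    fun_prop
  · have := hm w (by simp; linarith)
    rw [dist_eq_norm] at this
    exact this.le

/-- The principal part at `z` of `φ / (w - z) ^ m`, together with its expression in the
coordinate `1 / w`. -/
theorem exists_principal_part {z : ℂ} (m : ℕ) : ∀ {φ : ℂ → ℂ}, AnalyticAt ℂ φ z →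
    ∃ P Q : ℂ → ℂ, (∀ w, w ≠ z → DifferentiableAt ℂ P w) ∧
      (∀ u, 1 - z * u ≠ 0 → DifferentiableAt ℂ Q u) ∧ (∀ w, w ≠ 0 → Q w⁻¹ = P w) ∧
      ∃ r, AnalyticAt ℂ r z ∧ ∀ w, w ≠ z → φ w / (w - z) ^ m = P w + r w := by
  induction m with
  | zero =>
    intro φ hφ
    exact ⟨0, 0, fun w _ => differentiableAt_const _, fun w _ => differentiableAt_const _,
      fun _ _ => rfl, φ, hφ, fun w _ => by simp⟩
  | succ m ih =>
    intro φ hφ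
    obtain ⟨p, hp⟩ := hφ
    obtain ⟨P, Q, hP, hQ, hPQ, r, hr, h⟩ := ih ⟨_, hp.has_fpower_series_dslope_fslope⟩
    refine ⟨fun w => φ z / (w - z) ^ (m + 1) + P w,
      fun u => φ z * (u / (1 - z * u)) ^ (m + 1) + Q u, fun w hw => ?_, fun u hu => ?_,
      fun w hw => ?_, r, hr, fun w hw => ?_⟩
    · have := hP w hw
      have h0 : (w - z) ^ (m + 1) ≠ 0 := pow_ne_zero _ (sub_ne_zero.2 hw)
      fun_prop (disch := assumption)
    · have := hQ u hu
      fun_prop (disch := assumption)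
    · simp only [hPQ w hw]
      congr 1
      have : w⁻¹ / (1 - z * w⁻¹) = (w - z)⁻¹ := by
        rw [← one_div_one_div (w - z)⁻¹]
        rw [div_eq_mul_inv, ← mul_inv]
        field_simp
      rw [this, inv_pow, div_eq_mul_inv]
    · have h0 : w - z ≠ 0 := sub_ne_zero.2 hw
      have h1 := h w hw
      have h2 : φ w = φ z + (w - z) * dslope φ z w := by
        rw [← smul_eq_mul, sub_smul_dslope]; ring
      rw [add_assoc, ← h1, h2]
      field_simp
      ring

/-- A correction of `P` by a function holomorphic on the punctured plane that is small away from
the annulus `‖w‖ / 2 < ‖z‖ < 2 ‖w‖`. -/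
theorem exists_small_correction {z : ℂ} (hz : z ≠ 0) {P Q : ℂ → ℂ}
    (hP : ∀ w, w ≠ z → DifferentiableAt ℂ P w)
    (hQ : ∀ u, 1 - z * u ≠ 0 → DifferentiableAt ℂ Q u) (hPQ : ∀ w, w ≠ 0 → Q w⁻¹ = P w)
    {ε : ℝ} (hε : 0 < ε) :
    ∃ q : ℂ → ℂ, DifferentiableOn ℂ q {0}ᶜ ∧
      (1 ≤ ‖z‖ → ∀ w, 2 * ‖w‖ ≤ ‖z‖ → ‖P w - q w‖ ≤ ε) ∧
      (‖z‖ < 1 → ∀ w, w ≠ 0 → 2 * ‖z‖ ≤ ‖w‖ → ‖P w - q w‖ ≤ ε) := by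
  have hz' : 0 < ‖z‖ := norm_pos_iff.2 hz
  rcases le_or_gt 1 ‖z‖ with h | h
  · obtain ⟨q, hq, hb⟩ := exists_entire_approx (ψ := P) (r := ‖z‖ / 2) (R := ‖z‖) (by positivity)
      (by linarith) (fun w hw => (hP w (by
        rintro rfl; simp at hw)).differentiableWithinAt) hε
    exact ⟨q, hq.differentiableOn, fun _ w hw => hb w (by linarith), fun h' => by linarith⟩
  · obtain ⟨q, hq, hb⟩ := exists_entire_approx (ψ := Q) (r := ‖z‖⁻¹ / 2) (R := ‖z‖⁻¹)
      (by positivity) (half_lt_self (by positivity)) (fun w hw => (hQ w (by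
        intro h0
        rw [sub_eq_zero] at h0
        have : w = z⁻¹ := by field_simp; rw [mul_comm]; exact h0.symm
        rw [this] at hw
        simp at hw)).differentiableWithinAt) hε
    refine ⟨fun w => q w⁻¹, fun w hw => ?_, fun h' => by linarith, fun _ w hw hzw => ?_⟩
    · exact ((hq w⁻¹).comp w (differentiableAt_inv hw)).differentiableWithinAt
    · rw [← hPQ w hw]
      apply hb
      rw [norm_inv, inv_le_comm₀ (norm_pos_iff.2 hw) (by positivity)]
      simpa [mul_comm] using hzw

/-- The Mittag-Leffler theorem on the punctured plane, for prescribed singular parts that are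
holomorphic near infinity and near the origin. -/
theorem mittagLeffler_punctured {Z : Set ℂ} (hZ0 : (0 : ℂ) ∉ Z)
    (hfin : ∀ R : ℝ, 0 < R → {z ∈ Z | R⁻¹ ≤ ‖z‖ ∧ ‖z‖ ≤ R}.Finite) {P Q : ℂ → ℂ → ℂ}
    (hP : ∀ z ∈ Z, ∀ w, w ≠ z → DifferentiableAt ℂ (P z) w)
    (hQ : ∀ z ∈ Z, ∀ u, 1 - z * u ≠ 0 → DifferentiableAt ℂ (Q z) u)
    (hPQ : ∀ z ∈ Z, ∀ w, w ≠ 0 → Q z w⁻¹ = P z w) :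
    ∃ p : ℂ → ℂ, (∀ w, w ≠ 0 → w ∉ Z → AnalyticAt ℂ p w) ∧
      ∀ z ∈ Z, ∃ r, AnalyticAt ℂ r z ∧ ∀ᶠ w in 𝓝[≠] z, p w = P z w + r w := by
  classical
  have hcount : Z.Countable := by
    have : Z = ⋃ m : ℕ, {z ∈ Z | ((m : ℝ) + 1)⁻¹ ≤ ‖z‖ ∧ ‖z‖ ≤ (m : ℝ) + 1} := by
      ext z
      simp only [mem_iUnion, mem_ofPred_eq]
      refine ⟨fun hz => ?_, fun ⟨_, h, _⟩ => h⟩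
      have hz0 : 0 < ‖z‖ := norm_pos_iff.2 (by rintro rfl; exact hZ0 hz)
      obtain ⟨m, hm⟩ := exists_nat_ge (max ‖z‖ ‖z‖⁻¹)
      refine ⟨m, hz, ?_, ?_⟩
      · rw [inv_le_comm₀ (by positivity) hz0]
        linarith [le_max_right ‖z‖ ‖z‖⁻¹]
      · linarith [le_max_left ‖z‖ ‖z‖⁻¹]
    rw [this]
    exact countable_iUnion fun m => (hfin _ (by positivity)).countable
  obtain ⟨ε, hε, c, hc, -⟩ := hcount.exists_pos_hasSum_le (ε := 1) one_pos
  have key : ∀ z : Z, ∃ q : ℂ → ℂ, DifferentiableOn ℂ q {0}ᶜ ∧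
      (1 ≤ ‖(z : ℂ)‖ → ∀ w, 2 * ‖w‖ ≤ ‖(z : ℂ)‖ → ‖P z w - q w‖ ≤ ε z) ∧
      (‖(z : ℂ)‖ < 1 → ∀ w, w ≠ 0 → 2 * ‖(z : ℂ)‖ ≤ ‖w‖ → ‖P z w - q w‖ ≤ ε z) := fun z =>
    exists_small_correction (by rintro h; exact hZ0 (h ▸ z.2)) (hP z z.2) (hQ z z.2)
      (hPQ z z.2) (hε z)
  choose q hq hq1 hq2 using key
  have hlocal : ∀ w₀ : ℂ, w₀ ≠ 0 → ∃ U : Set ℂ, IsOpen U ∧ w₀ ∈ U ∧ (0 : ℂ) ∉ U ∧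
      ∃ (A : Finset Z) (g : ℂ → ℂ), (∀ z : Z, (z : ℂ) ∈ U → z ∈ A) ∧ DifferentiableOn ℂ g U ∧
        (∀ w ∈ U, ∑' z : Z, (P z w - q z w) = (∑ z ∈ A, (P z w - q z w)) + g w) := by
    intro w₀ hw₀
    have hw₀' : 0 < ‖w₀‖ := norm_pos_iff.2 hw₀
    obtain ⟨R, hR⟩ := exists_gt (max 1 (max ‖w₀‖ ‖w₀‖⁻¹))
    have hR1 : 1 < R := lt_of_le_of_lt (le_max_left _ _) hR
    have hR2 : ‖w₀‖ < R := lt_of_le_of_lt ((le_max_left _ _).trans (le_max_right _ _)) hR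
    have hR3 : ‖w₀‖⁻¹ < R := lt_of_le_of_lt ((le_max_right _ _).trans (le_max_right _ _)) hR
    have hR0 : 0 < R := by linarith
    set A' := {z ∈ Z | (2 * R)⁻¹ ≤ ‖z‖ ∧ ‖z‖ ≤ 2 * R} with hA'
    have hA'fin : A'.Finite := hfin (2 * R) (by positivity)
    have hAfin : {z : Z | (z : ℂ) ∈ A'}.Finite := hA'fin.preimage Subtype.val_injective.injOn
    set U := {w : ℂ | R⁻¹ < ‖w‖ ∧ ‖w‖ < R} with hU
    have hUopen : IsOpen U := (isOpen_lt continuous_const continuous_norm).inter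
      (isOpen_lt continuous_norm continuous_const)
    have hU0 : (0 : ℂ) ∉ U := by
      simp only [hU, mem_ofPred_eq, norm_zero, not_and_or, not_lt]
      left; positivity
    have hbound : ∀ z : Z, z ∉ hAfin.toFinset → ∀ w ∈ U, ‖P z w - q z w‖ ≤ ε z := by
      intro z hz w hw
      have hw0 : w ≠ 0 := by rintro rfl; exact hU0 hw
      have hz' : ¬ ((2 * R)⁻¹ ≤ ‖(z : ℂ)‖ ∧ ‖(z : ℂ)‖ ≤ 2 * R) := by
        intro h
        apply hz
        simp only [Set.Finite.mem_toFinset, mem_ofPred_eq, hA']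
        exact ⟨z.2, h⟩
      rcases le_or_gt 1 ‖(z : ℂ)‖ with h1 | h1
      · apply hq1 z h1
        have h2 : (2 * R)⁻¹ ≤ ‖(z : ℂ)‖ := by
          refine le_trans ?_ h1
          apply inv_le_one_of_one_le₀; linarith
        have : 2 * R < ‖(z : ℂ)‖ := by
          by_contra h3
          exact hz' ⟨h2, not_lt.1 h3⟩
        linarith [hw.2]
      · apply hq2 z h1 w hw0
        have : ‖(z : ℂ)‖ < (2 * R)⁻¹ := by
          by_contra h3
          exact hz' ⟨not_lt.1 h3, by linarith⟩
        have h4 : (2 * R)⁻¹ = R⁻¹ / 2 := by field_simp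
        linarith [hw.1]
    have hUA : ∀ z : Z, (z : ℂ) ∈ U → z ∈ hAfin.toFinset := by
      intro z hz
      simp only [Set.Finite.mem_toFinset, mem_ofPred_eq, hA']
      refine ⟨z.2, ?_, ?_⟩
      · refine le_trans ?_ hz.1.le
        gcongr; linarith
      · linarith [hz.2]
    refine ⟨U, hUopen, ⟨?_, hR2⟩, hU0, hAfin.toFinset,
      fun w => ∑' z : Z, if z ∈ hAfin.toFinset then 0 else (P z w - q z w), hUA, ?_, ?_⟩
    · rwa [inv_lt_comm₀ hR0 hw₀']
    · have hs : Summable fun z : Z => ε z := hc.summable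
      refine Complex.differentiableOn_tsum_of_summable_norm hs ?_ hUopen ?_
      · intro z
        by_cases hz : z ∈ hAfin.toFinset
        · simp only [hz, if_true]; exact differentiableOn_const _
        · simp only [hz, if_false]
          intro w hw
          have hw0 : w ≠ 0 := by rintro rfl; exact hU0 hw
          have hwz : w ≠ z := by
            rintro rfl
            exact hz (hUA z hw)
          exact ((hP z z.2 w hwz).sub
            ((hq z).differentiableAt (isOpen_compl_singleton.mem_nhds hw0))).differentiableWithinAt
      · intro z w hw
        by_cases hz : z ∈ hAfin.toFinset
        · simp only [hz, if_true, norm_zero]; exact (hε z).le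
        · simp only [hz, if_false]; exact hbound z hz w hw
    · intro w hw
      have hs1 : Summable fun z : Z =>
          if z ∈ hAfin.toFinset then 0 else (P z w - q z w) := by
        refine Summable.of_norm_bounded hc.summable fun z => ?_
        by_cases hz : z ∈ hAfin.toFinset
        · simp only [hz, if_true, norm_zero]; exact (hε z).le
        · simp only [hz, if_false]; exact hbound z hz w hw
      have hs2 : HasSum (fun z : Z => if z ∈ hAfin.toFinset then (P z w - q z w) else 0)
          (∑ z ∈ hAfin.toFinset, if z ∈ hAfin.toFinset then (P z w - q z w) else 0) :=
        hasSum_sum_of_ne_finset_zero fun z hz => by simp only [hz, if_false]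
      have h3 := (hs2.add hs1.hasSum).tsum_eq
      rw [← Finset.sum_congr rfl (fun z hz => if_pos hz), ← h3]
      congr 1
      ext z
      split_ifs <;> simp
  refine ⟨fun w => ∑' z : Z, (P z w - q z w), fun w₀ hw₀ hwZ => ?_, fun z hz => ?_⟩
  · obtain ⟨U, hUo, hwU, hU0, A, g, hUA, hg, heq⟩ := hlocal w₀ hw₀
    have hV : IsOpen (U \ ((A.image Subtype.val : Finset ℂ) : Set ℂ)) :=
      hUo.sdiff (Finset.finite_toSet _).isClosed
    have hd : DifferentiableOn ℂ (fun w => ∑' z : Z, (P z w - q z w))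
        (U \ ((A.image Subtype.val : Finset ℂ) : Set ℂ)) := by
      refine DifferentiableOn.congr (f := fun w => (∑ z ∈ A, (P z w - q z w)) + g w) ?_
        (fun w hw => heq w hw.1)
      refine DifferentiableOn.fun_add (DifferentiableOn.fun_sum fun z hzA w hw => ?_)
        (hg.mono sdiff_subset)
      refine ((hP z z.2 w ?_).sub ((hq z).differentiableAt
        (isOpen_compl_singleton.mem_nhds ?_))).differentiableWithinAt
      · rintro rfl
        exact hw.2 (by simpa using hzA)
      · rintro rfl; exact hU0 hw.1
    refine hd.analyticAt (hV.mem_nhds ⟨hwU, ?_⟩)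
    rw [Finset.coe_image]
    rintro ⟨x, -, rfl⟩
    exact hwZ x.2
  · have hz0 : z ≠ 0 := by rintro rfl; exact hZ0 hz
    obtain ⟨U, hUo, hwU, hU0, A, g, hUA, hg, heq⟩ := hlocal z hz0
    let z' : Z := ⟨z, hz⟩
    have hV : IsOpen (U \ (((A.erase z').image Subtype.val : Finset ℂ) : Set ℂ)) :=
      hUo.sdiff (Finset.finite_toSet _).isClosed
    have hzV : z ∈ U \ (((A.erase z').image Subtype.val : Finset ℂ) : Set ℂ) := by
      refine ⟨hwU, ?_⟩
      simp [z']
    have hd : DifferentiableOn ℂ (fun w => (∑ x ∈ A.erase z', (P x w - q x w)) + g w)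
        (U \ (((A.erase z').image Subtype.val : Finset ℂ) : Set ℂ)) := by
      refine DifferentiableOn.fun_add (DifferentiableOn.fun_sum fun x hxA w hw => ?_)
        (hg.mono sdiff_subset)
      refine ((hP x x.2 w ?_).sub ((hq x).differentiableAt
        (isOpen_compl_singleton.mem_nhds ?_))).differentiableWithinAt
      · rintro rfl
        apply hw.2
        rw [Finset.coe_image]
        exact ⟨x, hxA, rfl⟩
      · rintro rfl; exact hU0 hw.1
    refine ⟨fun w => ((∑ x ∈ A.erase z', (P x w - q x w)) + g w) - q z' w, ?_, ?_⟩
    · exact (hd.analyticAt (hV.mem_nhds hzV)).sub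
        ((hq z').analyticAt (isOpen_compl_singleton.mem_nhds hz0))
    · filter_upwards [mem_nhdsWithin_of_mem_nhds (hUo.mem_nhds hwU)] with w hw
      rw [heq w hw, ← Finset.add_sum_erase A _ (hUA z' hwU)]
      simp only [z']; ring

/-- A holomorphic function on the punctured plane that is not identically zero has finitely many
zeros in every compact annulus. -/
theorem finite_zeros_annulus {g : ℂ → ℂ} (hg : DifferentiableOn ℂ g {0}ᶜ)
    (hg0 : ∃ w, w ≠ 0 ∧ g w ≠ 0) (R : ℝ) (hR : 0 < R) :
    {z ∈ {w | w ≠ 0 ∧ g w = 0} | R⁻¹ ≤ ‖z‖ ∧ ‖z‖ ≤ R}.Finite := by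
  by_contra hinf
  have hK : IsCompact {z : ℂ | R⁻¹ ≤ ‖z‖ ∧ ‖z‖ ≤ R} := by
    refine (isCompact_closedBall (0 : ℂ) R).of_isClosed_subset
      ((isClosed_le continuous_const continuous_norm).inter
        (isClosed_le continuous_norm continuous_const)) ?_
    intro z hz
    simpa using hz.2
  obtain ⟨x, hxK, hx⟩ := Set.Infinite.exists_accPt_of_subset_isCompact hinf hK (fun z hz => hz.2)
  have hx0 : x ≠ 0 := by
    rintro rfl
    have := hxK.1
    rw [norm_zero] at this
    have h2 : 0 < R⁻¹ := by positivity
    linarith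
  rw [accPt_iff_frequently_nhdsNE] at hx
  obtain ⟨w, hw, hgw⟩ := hg0
  refine hgw ((hg.analyticOnNhd
    isOpen_compl_singleton).eqOn_zero_of_preconnected_of_frequently_eq_zero
    (isConnected_compl_singleton_of_one_lt_rank (by simp) 0).isPreconnected hx0
    (hx.mono fun z hz => hz.1.2) hw)

/-- The ring of holomorphic functions on the punctured plane has stable rank one. -/
theorem exists_add_mul_ne_zero {f g : ℂ → ℂ} (hf : DifferentiableOn ℂ f {0}ᶜ)
    (hg : DifferentiableOn ℂ g {0}ᶜ) (hfg : ∀ w, w ≠ 0 → g w = 0 → f w ≠ 0) :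
    ∃ h : ℂ → ℂ, DifferentiableOn ℂ h {0}ᶜ ∧ ∀ w, w ≠ 0 → f w + h w * g w ≠ 0 := by
  classical
  by_cases hg0 : ∃ w, w ≠ 0 ∧ g w ≠ 0
  swap
  · push Not at hg0
    exact ⟨0, differentiableOn_const _, fun w hw => by
      simpa using hfg w hw (hg0 w hw)⟩
  have hfin := finite_zeros_annulus hg hg0
  have hWo : IsOpen ({0}ᶜ : Set ℂ) := isOpen_compl_singleton
  have hga : ∀ w, w ≠ 0 → AnalyticAt ℂ g w := fun w hw => hg.analyticAt (hWo.mem_nhds hw)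
  have hfa : ∀ w, w ≠ 0 → AnalyticAt ℂ f w := fun w hw => hf.analyticAt (hWo.mem_nhds hw)
  have hgne : ∀ w, w ≠ 0 → ∀ᶠ v in 𝓝[≠] w, g v ≠ 0 := by
    intro w hw
    by_contra hcon
    obtain ⟨v, hv, hgv⟩ := hg0
    refine hgv ((hg.analyticOnNhd hWo).eqOn_zero_of_preconnected_of_frequently_eq_zero
      (isConnected_compl_singleton_of_one_lt_rank (by simp) 0).isPreconnected hw ?_ hv)
    exact (not_eventually.1 hcon).mono fun v hv => not_not.1 hv
  have key : ∀ z : ℂ, ∃ P Q : ℂ → ℂ, z ≠ 0 ∧ g z = 0 →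
      (∀ w, w ≠ z → DifferentiableAt ℂ P w) ∧
      (∀ u, 1 - z * u ≠ 0 → DifferentiableAt ℂ Q u) ∧ (∀ w, w ≠ 0 → Q w⁻¹ = P w) ∧
      ∃ r l, AnalyticAt ℂ r z ∧ AnalyticAt ℂ l z ∧ (∀ᶠ w in 𝓝 z, Complex.exp (l w) = f w) ∧
        ∀ᶠ w in 𝓝[≠] z, l w / g w = P w + r w := by
    intro z
    by_cases hz : z ≠ 0 ∧ g z = 0
    swap
    · exact ⟨0, 0, fun h => absurd h hz⟩
    have hfz := hfg z hz.1 hz.2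
    obtain ⟨m, g₁, hg₁, hg₁z, hgg₁⟩ :=
      (hga z hz.1).exists_eventuallyEq_pow_smul_nonzero_iff.2 (fun h =>
        ((hgne z hz.1).and (h.filter_mono nhdsWithin_le_nhds)).exists.elim fun w hw => hw.1 hw.2)
    let l : ℂ → ℂ := fun w => Complex.log (f w / f z) + Complex.log (f z)
    have hl : AnalyticAt ℂ l z := by
      refine AnalyticAt.add ?_ analyticAt_const
      refine AnalyticAt.clog ((hfa z hz.1).div analyticAt_const hfz) ?_
      rw [div_self hfz]
      exact Complex.one_mem_slitPlane
    obtain ⟨P, Q, hP, hQ, hPQ, r, hr, h⟩ := exists_principal_part m (hl.div hg₁ hg₁z)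
    refine ⟨P, Q, fun _ => ⟨hP, hQ, hPQ, r, l, hr, hl, ?_, ?_⟩⟩
    · filter_upwards [(hfa z hz.1).continuousAt.eventually_ne hfz] with w hw
      simp only [l]
      rw [Complex.exp_add, Complex.exp_log (div_ne_zero hw hfz), Complex.exp_log hfz,
        div_mul_cancel₀ _ hfz]
    · filter_upwards [hgg₁.filter_mono nhdsWithin_le_nhds, self_mem_nhdsWithin] with w hw hwz
      rw [← h w hwz, hw, Pi.div_apply, smul_eq_mul, div_div, mul_comm]
  choose P Q hPQ using key
  obtain ⟨p, hp1, hp2⟩ := mittagLeffler_punctured (Z := {w | w ≠ 0 ∧ g w = 0}) (P := P) (Q := Q)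
    (fun h => h.1 rfl) hfin (fun z hz => (hPQ z hz).1) (fun z hz => (hPQ z hz).2.1)
    (fun z hz => (hPQ z hz).2.2.1)
  -- near every point the quotient `(exp (g p) - f) / g` extends holomorphically
  have hext : ∀ z, z ≠ 0 → ∃ e : ℂ → ℂ, AnalyticAt ℂ e z ∧
      ∀ᶠ w in 𝓝[≠] z, (Complex.exp (g w * p w) - f w) / g w = e w := by
    intro z hz
    by_cases hgz : g z = 0
    · obtain ⟨-, -, -, r, l, hr, hl, hexp, hlg⟩ := hPQ z ⟨hz, hgz⟩
      obtain ⟨r', hr', hpr'⟩ := hp2 z ⟨hz, hgz⟩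
      let ψ : ℂ → ℂ := fun w => g w * (r' w - r w)
      have hψ : AnalyticAt ℂ ψ z := (hga z hz).mul (hr'.sub hr)
      refine ⟨fun w => f w * ((r' w - r w) * dslope Complex.exp 0 (ψ w)), ?_, ?_⟩
      · refine (hfa z hz).mul ((hr'.sub hr).mul ?_)
        have h0 : ψ z = 0 := by simp [ψ, hgz]
        have : AnalyticAt ℂ (dslope Complex.exp 0) (ψ z) := by
          rw [h0]
          obtain ⟨s, hs⟩ := (Complex.differentiable_exp.analyticAt 0)
          exact ⟨_, hs.has_fpower_series_dslope_fslope⟩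
        exact this.comp hψ
      · filter_upwards [hexp.filter_mono nhdsWithin_le_nhds, hlg, hpr', hgne z hz] with
          w h1 h2 h3 h4
        have h5 : g w * p w = l w + ψ w := by
          have : l w = g w * (P z w + r w) := by rw [← h2]; field_simp
          rw [h3, this]; simp only [ψ]; ring
        have h6 : Complex.exp (ψ w) = 1 + ψ w * dslope Complex.exp 0 (ψ w) := by
          have := sub_smul_dslope Complex.exp 0 (ψ w)
          rw [sub_zero, smul_eq_mul, Complex.exp_zero] at this
          rw [this]; ring
        rw [h5, Complex.exp_add, h1, h6]
        simp only [ψ]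
        field_simp
        ring
    · refine ⟨fun w => (Complex.exp (g w * p w) - f w) / g w, ?_, Eventually.of_forall
        fun _ => rfl⟩
      have := hp1 z hz (fun h => hgz h.2)
      exact (((hga z hz).mul this).cexp.sub (hfa z hz)).div (hga z hz) hgz
  choose! e he1 he2 using hext
  have hsame : ∀ z, z ≠ 0 → (fun w => e w w) =ᶠ[𝓝 z] e z := by
    intro z hz
    have h1 : ∀ᶠ v in 𝓝[≠] z, v ≠ 0 :=
      (isOpen_compl_singleton.mem_nhds hz : ({0}ᶜ : Set ℂ) ∈ 𝓝 z) |> mem_nhdsWithin_of_mem_nhds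
    have h2 : ∀ᶠ v in 𝓝[≠] z, g v ≠ 0 := hgne z hz
    have h3 : ∀ᶠ v in 𝓝[≠] z, e v v = e z v := by
      filter_upwards [h1, h2, he2 z hz] with v hv hgv hev
      rw [← hev]
      have hcont : ContinuousAt (fun w => (Complex.exp (g w * p w) - f w) / g w) v := by
        have := hp1 v hv (fun h => hgv h.2)
        exact ((((hga v hv).mul this).cexp.sub (hfa v hv)).div (hga v hv) hgv).continuousAt
      refine tendsto_nhds_unique ((he1 v hv).continuousAt.tendsto.mono_left nhdsWithin_le_nhds)
        ((hcont.tendsto.mono_left nhdsWithin_le_nhds).congr' (he2 v hv))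
    have h4 : ∀ᶠ v in 𝓝 z, e v v = e z v := by
      rw [← nhdsNE_sup_pure, Filter.eventually_sup, Filter.eventually_pure]
      exact ⟨h3, rfl⟩
    exact h4
  refine ⟨fun w => e w w, fun z hz =>
    ((he1 z hz).differentiableAt.congr_of_eventuallyEq (hsame z hz)).differentiableWithinAt,
    fun w hw => ?_⟩
  by_cases hgw : g w = 0
  · simpa [hgw] using hfg w hw hgw
  · have hcont : ContinuousAt (fun w => (Complex.exp (g w * p w) - f w) / g w) w := by
      have := hp1 w hw (fun h => hgw h.2)
      exact ((((hga w hw).mul this).cexp.sub (hfa w hw)).div (hga w hw) hgw).continuousAt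
    have : e w w = (Complex.exp (g w * p w) - f w) / g w :=
      tendsto_nhds_unique ((he1 w hw).continuousAt.tendsto.mono_left nhdsWithin_le_nhds)
        ((hcont.tendsto.mono_left nhdsWithin_le_nhds).congr' (he2 w hw))
    simp only [this]
    rw [div_mul_cancel₀ _ hgw, add_sub_cancel]
    exact Complex.exp_ne_zero _

/-- Finitely many holomorphic functions on the punctured plane without common zeros: adding
multiples of the others turns one of them into a nowhere vanishing function. -/
theorem exists_add_sum_mul_ne_zero {n : ℕ} (s : Finset (Fin n)) (j₀ : Fin n)
    {f : Fin n → ℂ → ℂ} (hf : ∀ j, DifferentiableOn ℂ (f j) {0}ᶜ)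
    (hne : ∀ w, w ≠ 0 → f j₀ w = 0 → ∃ j ∈ s, f j w ≠ 0) :
    ∃ c : Fin n → ℂ → ℂ, (∀ j, DifferentiableOn ℂ (c j) {0}ᶜ) ∧ (∀ j, j ∉ s → c j = 0) ∧
      ∀ w, w ≠ 0 → f j₀ w + ∑ j, c j w * f j w ≠ 0 := by
  classical
  have main : ∀ u : ℂ → ℂ, DifferentiableOn ℂ u {0}ᶜ → (∃ w, w ≠ 0 ∧ u w ≠ 0) →
      (∀ w, w ≠ 0 → u w = 0 → ∃ j ∈ s, f j w ≠ 0) →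
      ∃ c : Fin n → ℂ → ℂ, (∀ j, DifferentiableOn ℂ (c j) {0}ᶜ) ∧ (∀ j, j ∉ s → c j = 0) ∧
        ∀ w, w ≠ 0 → u w + ∑ j, c j w * f j w ≠ 0 := by
    intro u hu hu0 hune
    have hcount : {w | w ≠ 0 ∧ u w = 0}.Countable := by
      have : {w | w ≠ 0 ∧ u w = 0} ⊆ ⋃ m : ℕ, {z ∈ {w | w ≠ 0 ∧ u w = 0} |
          ((m : ℝ) + 1)⁻¹ ≤ ‖z‖ ∧ ‖z‖ ≤ (m : ℝ) + 1} := by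
        intro z hz
        have hz0 : 0 < ‖z‖ := norm_pos_iff.2 hz.1
        obtain ⟨m, hm⟩ := exists_nat_ge (max ‖z‖ ‖z‖⁻¹)
        refine mem_iUnion.2 ⟨m, hz, ?_, ?_⟩
        · rw [inv_le_comm₀ (by positivity) hz0]
          linarith [le_max_right ‖z‖ ‖z‖⁻¹]
        · linarith [le_max_left ‖z‖ ‖z‖⁻¹]
      exact (countable_iUnion fun m =>
        (finite_zeros_annulus hu hu0 _ (by positivity)).countable).mono this
    let p : ℂ → Polynomial ℂ := fun w =>
      ∑ j ∈ s, Polynomial.C (f j w) * Polynomial.X ^ (j : ℕ)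
    have hp : ∀ w, w ≠ 0 ∧ u w = 0 → p w ≠ 0 := by
      intro w hw hpw
      obtain ⟨j, hj, hfj⟩ := hune w hw.1 hw.2
      apply hfj
      have := congrArg (fun q => Polynomial.coeff q j) hpw
      simp only [p, Polynomial.finsetSum_coeff, Polynomial.coeff_C_mul, Polynomial.coeff_X_pow,
        Polynomial.coeff_zero] at this
      rw [Finset.sum_eq_single j] at this
      · simpa using this
      · intro i _ hij
        rw [if_neg (fun h => hij (Fin.ext h.symm)), mul_zero]
      · exact fun h => absurd hj h
    have hbad : (⋃ w ∈ {w | w ≠ 0 ∧ u w = 0}, ((p w).roots.toFinset : Set ℂ)).Countable :=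
      hcount.biUnion fun w _ => (Finset.finite_toSet _).countable
    obtain ⟨t, ht⟩ : ∃ t, t ∉ ⋃ w ∈ {w | w ≠ 0 ∧ u w = 0}, ((p w).roots.toFinset : Set ℂ) := by
      by_contra hcon
      push Not at hcon
      exact not_countable_complex (hbad.mono fun t _ => hcon t)
    have hgt : ∀ w, (p w).eval t = ∑ j ∈ s, t ^ (j : ℕ) * f j w := by
      intro w
      simp only [p, Polynomial.eval_finsetSum, Polynomial.eval_mul, Polynomial.eval_C,
        Polynomial.eval_pow, Polynomial.eval_X]
      exact Finset.sum_congr rfl fun j _ => mul_comm _ _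
    obtain ⟨h, hh, hh0⟩ := exists_add_mul_ne_zero (f := u)
      (g := fun w => ∑ j ∈ s, t ^ (j : ℕ) * f j w) hu
      (DifferentiableOn.fun_sum fun j _ => (hf j).const_mul _) (by
        intro w hw hg hu
        apply ht
        refine mem_iUnion₂.2 ⟨w, ⟨hw, hu⟩, ?_⟩
        rw [← hgt] at hg
        simpa [hp w ⟨hw, hu⟩] using hg)
    refine ⟨fun j w => if j ∈ s then h w * t ^ (j : ℕ) else 0, fun j => ?_, fun j hj => ?_,
      fun w hw => ?_⟩
    · by_cases hj : j ∈ s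
      · simpa only [hj, if_true] using hh.mul_const _
      · simpa only [hj, if_false] using differentiableOn_const _
    · ext w; simp [hj]
    · have := hh0 w hw
      rw [Finset.mul_sum] at this
      convert this using 2
      rw [← Finset.sum_subset (Finset.subset_univ s)]
      · refine Finset.sum_congr rfl fun j hj => ?_
        simp only [hj, if_true]; ring
      · intro j _ hj
        simp [hj]
  by_cases h0 : ∃ w, w ≠ 0 ∧ f j₀ w ≠ 0
  · exact main (f j₀) (hf j₀) h0 hne
  · push Not at h0
    obtain ⟨j, hj, hfj⟩ := hne 1 one_ne_zero (h0 1 one_ne_zero)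
    obtain ⟨c, hc, hcs, hc0⟩ := main (f j) (hf j) ⟨1, one_ne_zero, hfj⟩
      (fun w hw _ => hne w hw (h0 w hw))
    refine ⟨fun i w => c i w + if i = j then 1 else 0, fun i => (hc i).add_const _, fun i hi => ?_,
      fun w hw => ?_⟩
    · ext w
      have : i ≠ j := by rintro rfl; exact hi hj
      simp [hcs i hi, this]
    · rw [h0 w hw]
      simp only [add_mul, Finset.sum_add_distrib, ite_mul, one_mul, zero_mul, Finset.sum_ite_eq',
        Finset.mem_univ, if_true, zero_add]
      rw [add_comm]
      exact hc0 w hw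

end JetInterpolation

namespace JetInterpolation
open Filter Topology Set

/-- A continuous logarithm of a holomorphic function is holomorphic. -/
theorem differentiableAt_of_exp_eq {f g : ℂ → ℂ} {z : ℂ} (hf : DifferentiableAt ℂ f z)
    (hg : ContinuousAt g z) (hfg : ∀ᶠ w in 𝓝 z, f w = Complex.exp (g w)) :
    DifferentiableAt ℂ g z := by
  have hz : f z = Complex.exp (g z) := hfg.self_of_nhds
  have hsmall : ∀ᶠ w in 𝓝 z, |(g w - g z).im| < Real.pi := by
    have : ContinuousAt (fun w => |(g w - g z).im|) z :=
      (Complex.continuous_im.continuousAt.comp (hg.sub continuousAt_const)).abs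
    exact this.eventually_lt continuousAt_const (by simpa using Real.pi_pos)
  have heq : g =ᶠ[𝓝 z] fun w => g z + Complex.log (f w / f z) := by
    filter_upwards [hfg, hsmall] with w hw hs
    rw [abs_lt] at hs
    rw [hw, hz, ← Complex.exp_sub, Complex.log_exp hs.1 hs.2.le]
    ring
  refine DifferentiableAt.congr_of_eventuallyEq ?_ heq
  refine ((hf.div_const _).clog ?_).const_add _
  rw [div_self (by rw [hz]; exact Complex.exp_ne_zero _)]
  exact Complex.one_mem_slitPlane

/-- A holomorphic function on the punctured plane which is homotopic to a constant through
nowhere vanishing functions has a holomorphic logarithm. -/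
theorem exists_log_of_nullhomotopic {D : unitInterval × {w : ℂ // w ≠ 0} → ℂ}
    (hD : Continuous D) (hD0 : ∀ q, D q ≠ 0) {c : ℂ} (hc : ∀ w, D (1, w) = c)
    {f : ℂ → ℂ} (hf : DifferentiableOn ℂ f {0}ᶜ)
    (hfD : ∀ w : {w : ℂ // w ≠ 0}, D (0, w) = f w) :
    ∃ g : ℂ → ℂ, DifferentiableOn ℂ g {0}ᶜ ∧ ∀ w, w ≠ 0 → f w = Complex.exp (g w) := by
  have hc0 : c ≠ 0 := hc ⟨1, one_ne_zero⟩ ▸ hD0 _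
  let H : C(unitInterval × {w : ℂ // w ≠ 0}, {w : ℂ // w ≠ 0}) :=
    ⟨fun q => ⟨D (unitInterval.symm q.1, q.2), hD0 _⟩, by fun_prop⟩
  let K := Complex.isCoveringMap_exp.liftHomotopy H (ContinuousMap.const _ (Complex.log c))
    (fun w => Subtype.ext (by simp [H, hc, Complex.exp_log hc0]))
  have hK : ∀ q, Complex.exp (K q) = D (unitInterval.symm q.1, q.2) := fun q =>
    congrArg Subtype.val (congrFun (Complex.isCoveringMap_exp.liftHomotopy_lifts H _ _) q)
  classical
  let g : ℂ → ℂ := fun w => if h : w ≠ 0 then K (1, ⟨w, h⟩) else 0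
  have hexp : ∀ w, w ≠ 0 → f w = Complex.exp (g w) := by
    intro w hw
    simp only [g, dif_pos hw]
    rw [hK, unitInterval.symm_one, hfD]
  have hgc : ContinuousOn g {0}ᶜ := by
    rw [continuousOn_iff_continuous_domRestrict]
    have : ({0}ᶜ : Set ℂ).domRestrict g = fun w => K (1, ⟨w.1, w.2⟩) := by
      ext w
      exact dif_pos w.2
    rw [this]
    exact K.continuous.comp (by fun_prop)
  refine ⟨g, fun z hz => ?_, hexp⟩
  have hnhds : ({0}ᶜ : Set ℂ) ∈ 𝓝 z := isOpen_compl_singleton.mem_nhds hz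
  refine (differentiableAt_of_exp_eq ((hf z hz).differentiableAt hnhds)
    ((hgc z hz).continuousAt hnhds) ?_).differentiableWithinAt
  filter_upwards [hnhds] with w hw using hexp w hw

end JetInterpolation

namespace JetInterpolation
open Filter Topology Set

variable {E : Type*} [NormedAddCommGroup E] [NormedSpace ℂ E]

/-- A holomorphic family, parametrized by the punctured plane, of holomorphic automorphisms of
`E`, together with the family of inverses. -/
structure IsAutFamily (F G : ℂ × E → E) : Prop where
  analyticAt : ∀ w z, w ≠ 0 → AnalyticAt ℂ F (w, z)
  analyticAt_inv : ∀ w z, w ≠ 0 → AnalyticAt ℂ G (w, z)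
  left_inv : ∀ w z, w ≠ 0 → G (w, F (w, z)) = z
  right_inv : ∀ w z, w ≠ 0 → F (w, G (w, z)) = z

/-- A holomorphic family of automorphisms of `E` with complex Jacobian `1`. -/
structure IsVolFamily (F G : ℂ × E → E) : Prop extends IsAutFamily F G where
  det_fderiv : ∀ w z, w ≠ 0 → (fderiv ℂ (fun z => F (w, z)) z).det = 1

theorem analyticAt_slice {F : ℂ × E → E} {w : ℂ} {z : E} (h : AnalyticAt ℂ F (w, z)) :
    AnalyticAt ℂ (fun z => F (w, z)) z :=
  AnalyticAt.fun_comp (g := F) h (analyticAt_const.prod analyticAt_id)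

namespace IsAutFamily

variable {F G F₁ G₁ F₂ G₂ : ℂ × E → E}

theorem analyticAt_slice (h : IsAutFamily F G) {w : ℂ} (hw : w ≠ 0) (z : E) :
    AnalyticAt ℂ (fun z => F (w, z)) z := JetInterpolation.analyticAt_slice (h.analyticAt w z hw)

theorem symm (h : IsAutFamily F G) : IsAutFamily G F :=
  ⟨h.analyticAt_inv, h.analyticAt, h.right_inv, h.left_inv⟩

theorem comp (h₁ : IsAutFamily F₁ G₁) (h₂ : IsAutFamily F₂ G₂) :
    IsAutFamily (fun q => F₁ (q.1, F₂ q)) (fun q => G₂ (q.1, G₁ q)) where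
  analyticAt w z hw := AnalyticAt.fun_comp (g := F₁) (h₁.analyticAt w _ hw)
    (analyticAt_fst.prod (h₂.analyticAt w z hw))
  analyticAt_inv w z hw := AnalyticAt.fun_comp (g := G₂) (h₂.analyticAt_inv w _ hw)
    (analyticAt_fst.prod (h₁.analyticAt_inv w z hw))
  left_inv w z hw := by simp only [h₁.left_inv _ _ hw, h₂.left_inv _ _ hw]
  right_inv w z hw := by simp only [h₁.right_inv _ _ hw, h₂.right_inv _ _ hw]

theorem injective (h : IsAutFamily F G) {w : ℂ} (hw : w ≠ 0) :
    Function.Injective fun z => F (w, z) :=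
  Function.LeftInverse.injective (g := fun z => G (w, z)) fun z => h.left_inv w z hw

theorem id : IsAutFamily (fun q : ℂ × E => q.2) (fun q => q.2) where
  analyticAt _ _ _ := analyticAt_snd
  analyticAt_inv _ _ _ := analyticAt_snd
  left_inv _ _ _ := rfl
  right_inv _ _ _ := rfl

theorem fderiv_comp (h₁ : IsAutFamily F₁ G₁) (h₂ : IsAutFamily F₂ G₂) {w : ℂ} (hw : w ≠ 0)
    (z : E) : fderiv ℂ (fun z => F₁ (w, F₂ (w, z))) z =
      (fderiv ℂ (fun z => F₁ (w, z)) (F₂ (w, z))).comp (fderiv ℂ (fun z => F₂ (w, z)) z) :=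
  _root_.fderiv_comp z (h₁.analyticAt_slice hw _).differentiableAt
    (h₂.analyticAt_slice hw z).differentiableAt

theorem fderiv_inv_comp (h : IsAutFamily F G) {w : ℂ} (hw : w ≠ 0) (z : E) :
    (fderiv ℂ (fun z => G (w, z)) (F (w, z))).comp (fderiv ℂ (fun z => F (w, z)) z) =
      ContinuousLinearMap.id ℂ E := by
  rw [← h.symm.fderiv_comp h hw]
  simp only [h.left_inv _ _ hw]
  exact fderiv_fun_id

theorem fderiv_comp_inv (h : IsAutFamily F G) {w : ℂ} (hw : w ≠ 0) (z : E) :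
    (fderiv ℂ (fun z => F (w, z)) z).comp (fderiv ℂ (fun z => G (w, z)) (F (w, z))) =
      ContinuousLinearMap.id ℂ E := by
  have := h.symm.fderiv_inv_comp hw (F (w, z))
  rwa [h.left_inv _ _ hw] at this

/-- Shears are automorphisms. -/
theorem shear {f : ℂ × E → E} (hf : ∀ w z, w ≠ 0 → AnalyticAt ℂ f (w, z))
    (hinv : ∀ w z z', w ≠ 0 → f (w, z + f (w, z')) = f (w, z)) :
    IsAutFamily (fun q => q.2 + f q) (fun q => q.2 - f q) where
  analyticAt w z hw := analyticAt_snd.add (hf w z hw)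
  analyticAt_inv w z hw := analyticAt_snd.sub (hf w z hw)
  left_inv w z hw := by simp only [hinv w z z hw, add_sub_cancel_right]
  right_inv w z hw := by
    have := hinv w (z - f (w, z)) z hw
    rw [sub_add_cancel] at this
    simp only [← this, sub_add_cancel]

/-- Overshears are automorphisms. -/
theorem overshear {η : ℂ × E → ℂ} (hη : ∀ w z, w ≠ 0 → AnalyticAt ℂ η (w, z)) {v : E}
    (hinv : ∀ w z (t : ℂ), w ≠ 0 → η (w, z + t • v) = η (w, z)) (μ : E →L[ℂ] ℂ) (hμ : μ v = 1)
    (x : E) :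
    IsAutFamily (fun q => q.2 + ((Complex.exp (η q) - 1) * μ (q.2 - x)) • v)
      (fun q => q.2 + ((Complex.exp (-η q) - 1) * μ (q.2 - x)) • v) := by
  have hμa : ∀ q : ℂ × E, AnalyticAt ℂ (fun q : ℂ × E => μ (q.2 - x)) q := fun q =>
    (μ.analyticAt _).fun_comp (analyticAt_snd.sub analyticAt_const)
  have key : ∀ (θ : ℂ × E → ℂ), (∀ w z (t : ℂ), w ≠ 0 → θ (w, z + t • v) = θ (w, z)) →
      ∀ w z, w ≠ 0 → z + ((Complex.exp (θ (w, z)) - 1) * μ (z - x)) • v +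
        ((Complex.exp (-θ (w, z + ((Complex.exp (θ (w, z)) - 1) * μ (z - x)) • v)) - 1) *
          μ (z + ((Complex.exp (θ (w, z)) - 1) * μ (z - x)) • v - x)) • v = z := by
    intro θ hθ w z hw
    rw [hθ _ _ _ hw, add_assoc, ← add_smul, add_sub_right_comm, map_add, map_smul, hμ]
    have : (Complex.exp (θ (w, z)) - 1) * μ (z - x) + (Complex.exp (-θ (w, z)) - 1) *
        (μ (z - x) + ((Complex.exp (θ (w, z)) - 1) * μ (z - x)) • (1 : ℂ)) = 0 := by
      have h := Complex.exp_ne_zero (θ (w, z))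
      rw [Complex.exp_neg, smul_eq_mul]
      field_simp
      ring
    rw [this, zero_smul, add_zero]
  refine ⟨fun w z hw => ?_, fun w z hw => ?_, fun w z hw => key η hinv w z hw, fun w z hw => ?_⟩
  · exact analyticAt_snd.add ((((hη w z hw).cexp.sub analyticAt_const).mul (hμa _)).smul
      analyticAt_const)
  · exact analyticAt_snd.add ((((hη w z hw).neg.cexp.sub analyticAt_const).mul (hμa _)).smul
      analyticAt_const)
  · have := key (fun q => -η q) (fun w z t hw => by rw [hinv w z t hw]) w z hw
    simpa only [neg_neg] using this

end IsAutFamily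

theorem det_one_add_of_comp_self_eq_zero [FiniteDimensional ℂ E] {S : E →L[ℂ] E}
    (hS : S.comp S = 0) : (ContinuousLinearMap.id ℂ E + S).det = 1 := by
  let φ : E →ₗ[ℂ] E := -(S : E →ₗ[ℂ] E)
  have hφ : ∀ v, (φ ^ 2) v = 0 := by
    intro v
    have := congrArg (fun T : E →L[ℂ] E => T v) hS
    simpa [φ, pow_two] using this
  have h1 : φ.charpoly = Polynomial.X ^ Module.finrank ℂ E :=
    (LinearMap.charpoly_eq_X_pow_iff φ).2 fun m => ⟨2, hφ m⟩
  have h2 := φ.eval_charpoly (1 : ℂ)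
  rw [h1] at h2
  simp only [Polynomial.eval_pow, Polynomial.eval_X, one_pow, map_one] at h2
  rw [h2, ContinuousLinearMap.det]
  congr 1
  ext v
  simp [φ]

namespace IsVolFamily

variable {F G F₁ G₁ F₂ G₂ : ℂ × E → E}

theorem comp (h₁ : IsVolFamily F₁ G₁) (h₂ : IsVolFamily F₂ G₂) :
    IsVolFamily (fun q => F₁ (q.1, F₂ q)) (fun q => G₂ (q.1, G₁ q)) where
  toIsAutFamily := h₁.toIsAutFamily.comp h₂.toIsAutFamily
  det_fderiv w z hw := by
    rw [h₁.toIsAutFamily.fderiv_comp h₂.toIsAutFamily hw]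
    have a := h₁.det_fderiv w (F₂ (w, z)) hw
    have b := h₂.det_fderiv w z hw
    rw [ContinuousLinearMap.det] at a b ⊢
    rw [ContinuousLinearMap.toLinearMap_comp, LinearMap.det_comp, a, b, one_mul]

theorem symm (h : IsVolFamily F G) : IsVolFamily G F where
  toIsAutFamily := h.toIsAutFamily.symm
  det_fderiv w z hw := by
    have a := h.det_fderiv w (G (w, z)) hw
    have b := h.toIsAutFamily.symm.fderiv_inv_comp hw z
    have c := congrArg (fun T : E →L[ℂ] E => LinearMap.det (T : E →ₗ[ℂ] E)) b
    simp only [ContinuousLinearMap.toLinearMap_comp, LinearMap.det_comp] at c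
    rw [ContinuousLinearMap.det] at a ⊢
    rw [a, one_mul] at c
    rw [c]
    simp

theorem id : IsVolFamily (fun q : ℂ × E => q.2) (fun q => q.2) where
  toIsAutFamily := IsAutFamily.id
  det_fderiv w z hw := by
    simp only [fderiv_fun_id]
    simp [ContinuousLinearMap.det]

theorem shear [FiniteDimensional ℂ E] {f : ℂ × E → E}
    (hf : ∀ w z, w ≠ 0 → AnalyticAt ℂ f (w, z))
    (hinv : ∀ w z z', w ≠ 0 → f (w, z + f (w, z')) = f (w, z)) :
    IsVolFamily (fun q => q.2 + f q) (fun q => q.2 - f q) where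
  toIsAutFamily := IsAutFamily.shear hf hinv
  det_fderiv w z hw := by
    have hd : ∀ z, DifferentiableAt ℂ (fun z => f (w, z)) z := fun z =>
      (analyticAt_slice (hf w z hw)).differentiableAt
    rw [show fderiv ℂ (fun z => z + f (w, z)) z =
      ContinuousLinearMap.id ℂ E + fderiv ℂ (fun z => f (w, z)) z by
        rw [fderiv_fun_add differentiableAt_fun_id (hd z), fderiv_fun_id]]
    apply det_one_add_of_comp_self_eq_zero
    have h1 : fderiv ℂ (fun z' => f (w, z + f (w, z'))) z = 0 := by
      simp only [hinv _ _ _ hw]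
      simp
    have h2 : fderiv ℂ (fun z' => f (w, z')) (z + f (w, z)) = fderiv ℂ (fun z' => f (w, z')) z := by
      rw [← fderiv_comp_add_right]
      simp only [hinv _ _ _ hw]
    have h3 := fderiv_comp z (g := fun z' => f (w, z')) (f := fun z' => z + f (w, z'))
      (hd _) ((hd z).const_add z)
    rw [fderiv_const_add, h2] at h3
    rw [← h3]
    exact h1

end IsVolFamily

end JetInterpolation

namespace JetInterpolation
open Filter Topology Set

variable {E : Type*} [NormedAddCommGroup E] [NormedSpace ℂ E]

theorem analyticAt_of_punctured {f : ℂ → E} [CompleteSpace E] (hf : DifferentiableOn ℂ f {0}ᶜ)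
    {w : ℂ} (hw : w ≠ 0) : AnalyticAt ℂ f w :=
  hf.analyticAt (isOpen_compl_singleton.mem_nhds hw)

theorem differentiableOn_punctured {f : ℂ → E} (hf : ∀ w, w ≠ 0 → AnalyticAt ℂ f w) :
    DifferentiableOn ℂ f {0}ᶜ :=
  fun w hw => (hf w hw).differentiableAt.differentiableWithinAt

variable [FiniteDimensional ℂ E] {n : ℕ}

/-- The coordinate functionals of a basis as continuous linear maps. -/
noncomputable def coordL (b : Module.Basis (Fin n) ℂ E) (j : Fin n) : E →L[ℂ] ℂ :=
  LinearMap.toContinuousLinearMap (b.coord j)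

theorem coordL_self (b : Module.Basis (Fin n) ℂ E) (i j : Fin n) :
    coordL b j (b i) = if i = j then 1 else 0 := by
  simp [coordL, Finsupp.single_apply]

theorem coordL_same (b : Module.Basis (Fin n) ℂ E) (i : Fin n) : coordL b i (b i) = 1 := by
  simp [coordL_self]

theorem coordL_of_ne (b : Module.Basis (Fin n) ℂ E) {i j : Fin n} (h : i ≠ j) :
    coordL b j (b i) = 0 := by
  simp [coordL_self, h]

theorem sum_coordL_smul (b : Module.Basis (Fin n) ℂ E) (z : E) :
    ∑ j, coordL b j z • b j = z := b.sum_repr z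

theorem ext_coordL (b : Module.Basis (Fin n) ℂ E) {z z' : E}
    (h : ∀ j, coordL b j z = coordL b j z') : z = z' := by
  rw [← sum_coordL_smul b z, ← sum_coordL_smul b z']
  simp only [h]

theorem analyticAt_coordL_snd (b : Module.Basis (Fin n) ℂ E) (j : Fin n) (q : ℂ × E) :
    AnalyticAt ℂ (fun q : ℂ × E => coordL b j q.2) q :=
  ((coordL b j).analyticAt _).fun_comp analyticAt_snd

/-- A point of a holomorphic family avoiding finitely many points of a coordinate axis can be moved
to another given point of the axis by a volume preserving family which fixes these points. -/
theorem exists_volFamily_move_axis (b : Module.Basis (Fin n) ℂ E) {o l : Fin n} (hol : o ≠ l)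
    {ι : Type*} (S : Finset ι) (a : ι → ℂ) (t : ℂ) (ht : ∀ i ∈ S, t ≠ a i) {p : ℂ → E}
    (hp : ∀ w, w ≠ 0 → AnalyticAt ℂ p w) (hpa : ∀ w, w ≠ 0 → ∀ i ∈ S, p w ≠ a i • b o) :
    ∃ V V' : ℂ × E → E, IsVolFamily V V' ∧
      (∀ w, w ≠ 0 → ∀ i ∈ S, V (w, a i • b o) = a i • b o) ∧
      ∀ w, w ≠ 0 → V (w, p w) = t • b o := by
  classical
  have : CompleteSpace E := FiniteDimensional.complete ℂ E
  let Q : ℂ → ℂ := fun s => ∏ i ∈ S, (s - a i)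
  have hQa : ∀ i ∈ S, Q (a i) = 0 := fun i hi => Finset.prod_eq_zero hi (sub_self _)
  have hQt : Q t ≠ 0 := Finset.prod_ne_zero_iff.2 fun i hi => sub_ne_zero.2 (ht i hi)
  have hQan : ∀ s, AnalyticAt ℂ Q s := fun s =>
    Finset.analyticAt_fun_prod _ fun i _ => analyticAt_id.sub analyticAt_const
  let g : Fin n → E → ℂ := fun j z => if j = o then Q (coordL b o z) else coordL b j z
  have hg : ∀ j z, AnalyticAt ℂ (g j) z := by
    intro j z
    by_cases hj : j = o
    · simp only [g, hj, if_true]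
      exact (hQan _).fun_comp ((coordL b o).analyticAt z)
    · simp only [g, hj, if_false]
      exact (coordL b j).analyticAt z
  obtain ⟨c, hc, hcl, hc0⟩ := exists_add_sum_mul_ne_zero (Finset.univ.erase l) l
    (f := fun j w => g j (p w))
    (fun j => differentiableOn_punctured fun w hw => (hg j _).fun_comp (hp w hw)) (by
      intro w hw h0
      by_contra hcon
      push Not at hcon
      simp only [Finset.mem_erase, Finset.mem_univ, and_true] at hcon
      have hQ0 : Q (coordL b o (p w)) = 0 := by simpa [g] using hcon o hol
      obtain ⟨i, hi, hia⟩ := Finset.prod_eq_zero_iff.1 hQ0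
      refine hpa w hw i hi (ext_coordL b fun j => ?_)
      rw [map_smul, coordL_self, smul_eq_mul]
      by_cases hj : o = j
      · subst hj
        simpa [sub_eq_zero] using hia
      · have : g j (p w) = 0 := by
          by_cases hjl : j = l
          · rw [hjl]; exact h0
          · exact hcon j hjl
        simpa [g, hj, Ne.symm hj] using this)
  have hcl0 : c l = 0 := hcl l (by simp)
  -- make the coordinate `l` nowhere zero
  have hV₁ := IsVolFamily.shear (E := E) (f := fun q => (∑ j, c j q.1 * g j q.2) • b l)
    (fun w z hw => (Finset.analyticAt_fun_sum _ fun j _ =>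
      ((analyticAt_of_punctured (hc j) hw).fun_comp_of_eq analyticAt_fst rfl).mul
        ((hg j _).fun_comp analyticAt_snd)).smul analyticAt_const)
    (fun w z z' hw => by
      dsimp only
      congr 1
      refine Finset.sum_congr rfl fun j _ => ?_
      by_cases hj : j = l
      · simp [hj, hcl0]
      · congr 1
        simp only [g, map_add, map_smul, coordL_of_ne b (Ne.symm hj),
          coordL_of_ne b hol.symm, smul_zero, add_zero])
  set p₁ : ℂ → E := fun w => p w + (∑ j, c j w * g j (p w)) • b l with hp₁
  have hp₁a : ∀ w, w ≠ 0 → AnalyticAt ℂ p₁ w := fun w hw =>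
    (hV₁.analyticAt w (p w) hw).fun_comp_of_eq
      (analyticAt_id.prod (hp w hw)) rfl
  have hp₁l : ∀ w, w ≠ 0 → coordL b l (p₁ w) ≠ 0 := by
    intro w hw
    have := hc0 w hw
    rw [hp₁]
    simp only [map_add, map_smul, coordL_same, smul_eq_mul, mul_one]
    simpa [g, hol.symm] using this
  have hca : ∀ j w, w ≠ 0 → AnalyticAt ℂ (fun w => coordL b j (p₁ w)) w := fun j w hw =>
    ((coordL b j).analyticAt _).fun_comp (hp₁a w hw)
  have hq : ∀ w, w ≠ 0 → AnalyticAt ℂ (fun w => (t - coordL b o (p₁ w)) / coordL b l (p₁ w)) w :=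
    fun w hw => (analyticAt_const.sub (hca o w hw)).div (hca l w hw) (hp₁l w hw)
  have hV₂ := IsVolFamily.shear (E := E) (f := fun q =>
      ((t - coordL b o (p₁ q.1)) / coordL b l (p₁ q.1) * coordL b l q.2) • b o)
    (fun w z hw => (((hq w hw).fun_comp_of_eq analyticAt_fst rfl).mul
      (analyticAt_coordL_snd b l _)).smul analyticAt_const)
    (fun w z z' hw => by
      simp only [map_add, map_smul, coordL_of_ne b hol, smul_zero, add_zero])
  set p₂ : ℂ → E := fun w => p₁ w +
    ((t - coordL b o (p₁ w)) / coordL b l (p₁ w) * coordL b l (p₁ w)) • b o with hp₂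
  have hp₂a : ∀ w, w ≠ 0 → AnalyticAt ℂ p₂ w := fun w hw =>
    (hV₂.analyticAt w (p₁ w) hw).fun_comp_of_eq (analyticAt_id.prod (hp₁a w hw)) rfl
  have hp₂o : ∀ w, w ≠ 0 → coordL b o (p₂ w) = t := by
    intro w hw
    simp only [hp₂, map_add, map_smul, coordL_same, smul_eq_mul, mul_one]
    rw [div_mul_cancel₀ _ (hp₁l w hw)]
    ring
  have hV₃ := IsVolFamily.shear (E := E) (f := fun q =>
      (-(Q (coordL b o q.2) / Q t)) • (p₂ q.1 - t • b o))
    (fun w z hw => ((((hQan _).fun_comp (analyticAt_coordL_snd b o _)).div_const).neg).smul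
      (((hp₂a w hw).fun_comp_of_eq analyticAt_fst rfl).sub analyticAt_const))
    (fun w z z' hw => by
      simp only [map_add, map_smul, map_sub, hp₂o w hw, coordL_same, smul_eq_mul, mul_one,
        sub_self, mul_zero, add_zero])
  refine ⟨_, _, (hV₃.comp hV₂).comp hV₁, fun w hw i hi => ?_, fun w hw => ?_⟩
  · have h1 : ∀ j, g j (a i • b o) = 0 := by
      intro j
      by_cases hj : j = o
      · simp [g, hj, coordL_same, hQa i hi]
      · simp [g, hj, coordL_of_ne b (Ne.symm hj)]
    simp only [h1, mul_zero, Finset.sum_const_zero, zero_smul, add_zero, map_smul,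
      coordL_of_ne b hol, coordL_same, smul_eq_mul, mul_one, hQa i hi, zero_div,
      neg_zero]
  · have e1 : p w + (∑ j, c j w * g j (p w)) • b l = p₁ w := rfl
    have e2 : p₁ w + ((t - coordL b o (p₁ w)) / coordL b l (p₁ w) * coordL b l (p₁ w)) • b o =
      p₂ w := rfl
    simp only [e1, e2, hp₂o w hw, div_self hQt]
    rw [neg_smul, one_smul]
    abel

/-- Finitely many points separated by a coordinate can be moved along any family of tuples of
distinct points by a volume preserving family of automorphisms. -/
theorem exists_volFamily_move (b : Module.Basis (Fin n) ℂ E) {o l : Fin n} (hol : o ≠ l)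
    {N : ℕ} (x : Fin N → E) (hx : Function.Injective fun i => coordL b o (x i))
    {y : Fin N → ℂ → E} (hy : ∀ i w, w ≠ 0 → AnalyticAt ℂ (y i) w)
    (hyne : ∀ w, w ≠ 0 → ∀ i i', i ≠ i' → y i w ≠ y i' w) :
    ∃ F G : ℂ × E → E, IsVolFamily F G ∧ ∀ w, w ≠ 0 → ∀ i, F (w, x i) = y i w := by
  classical
  set a : Fin N → ℂ := fun i => coordL b o (x i) with ha
  let R : ℂ → E := fun s => ∑ i, (Lagrange.basis Finset.univ a i).eval s • (x i - a i • b o)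
  have hRa : ∀ i, R (a i) = x i - a i • b o := by
    intro i
    simp only [R]
    rw [Finset.sum_eq_single i]
    · rw [Lagrange.eval_basis_self hx.injOn (Finset.mem_univ i), one_smul]
    · intro j _ hj
      rw [Lagrange.eval_basis_of_ne hj (Finset.mem_univ i), zero_smul]
    · exact fun h => absurd (Finset.mem_univ i) h
  have hRo : ∀ s, coordL b o (R s) = 0 := by
    intro s
    simp [R, ha, coordL_same]
  have hRan : ∀ s, AnalyticAt ℂ R s := fun s =>
    Finset.analyticAt_fun_sum _ fun i _ =>
      (AnalyticAt.aeval_polynomial (analyticAt_id) _).smul analyticAt_const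
  have hT := IsVolFamily.shear (E := E) (f := fun q => -R (coordL b o q.2))
    (fun w z hw => ((hRan _).fun_comp (analyticAt_coordL_snd b o _)).neg)
    (fun w z z' hw => by simp only [map_add, map_neg, hRo, neg_zero, add_zero])
  have hTx : ∀ i, x i + -R (coordL b o (x i)) = a i • b o := fun i => by
    rw [show coordL b o (x i) = a i from rfl, hRa]
    abel
  suffices h : ∀ S : Finset (Fin N), ∃ F G : ℂ × E → E, IsVolFamily F G ∧
      ∀ w, w ≠ 0 → ∀ i ∈ S, F (w, x i) = y i w by
    obtain ⟨F, G, hF, h⟩ := h Finset.univ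
    exact ⟨F, G, hF, fun w hw i => h w hw i (Finset.mem_univ i)⟩
  intro S
  induction S using Finset.induction_on with
  | empty => exact ⟨_, _, IsVolFamily.id, fun _ _ _ h => absurd h (Finset.notMem_empty _)⟩
  | insert m S hm ih =>
    obtain ⟨F, G, hF, hFx⟩ := ih
    have hp' : ∀ w, w ≠ 0 → AnalyticAt ℂ (fun w => G (w, y m w)) w := fun w hw =>
      (hF.analyticAt_inv w _ hw).fun_comp_of_eq (analyticAt_id.prod (hy m w hw)) rfl
    obtain ⟨V, V', hV, hVa, hVp⟩ := exists_volFamily_move_axis b hol S a (a m)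
      (fun i hi h => hm (hx h ▸ hi))
      (p := fun w => G (w, y m w) + -R (coordL b o (G (w, y m w))))
      (fun w hw => (hT.analyticAt w _ hw).fun_comp_of_eq
        (analyticAt_id.prod (hp' w hw)) rfl)
      (fun w hw i hi h => by
        rw [← hTx i] at h
        have h1 : G (w, y m w) = x i := hT.toIsAutFamily.injective hw h
        have h2 : y m w = y i w := by
          rw [← hFx w hw i hi, ← h1, hF.right_inv _ _ hw]
        exact hyne w hw m i (fun h => hm (h ▸ hi)) h2)
    have hU := (hT.symm.comp hV).comp hT
    refine ⟨_, _, hF.comp hU.symm, fun w hw i hi => ?_⟩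
    have key : ∀ u u', V (w, u + -R (coordL b o u)) = u' + -R (coordL b o u') →
        V' (w, u' + -R (coordL b o u')) = u + -R (coordL b o u) := fun u u' h => by
      rw [← h, hV.left_inv _ _ hw]
    dsimp only
    rcases Finset.mem_insert.1 hi with rfl | hi
    · rw [key (G (w, y i w)) (x i) (by rw [hVp w hw, hTx])]
      have := hT.left_inv w (G (w, y i w)) hw
      dsimp only at this
      rw [this, hF.right_inv _ _ hw]
    · rw [key (x i) (x i) (by rw [hTx, hVa w hw i hi])]
      have := hT.left_inv w (x i) hw
      dsimp only at this
      rw [this, hFx w hw i hi]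

end JetInterpolation

namespace JetInterpolation
open Filter Topology Set Matrix

variable {n : ℕ}

theorem one_add_vecMulVec_mul_apply (v c : Fin n → ℂ) (M : Matrix (Fin n) (Fin n) ℂ)
    (i j : Fin n) : ((1 + vecMulVec v c) * M) i j = M i j + v i * ∑ k, c k * M k j := by
  rw [add_mul, one_mul, Matrix.add_apply, vecMulVec_mul]
  simp [vecMulVec_apply, vecMul, dotProduct]

theorem dotProduct_eq_zero_of_disjoint {v c : Fin n → ℂ} (h : ∀ j, v j = 0 ∨ c j = 0) :
    c ⬝ᵥ v = 0 :=
  Finset.sum_eq_zero fun j _ => by rcases h j with h | h <;> simp [h]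

theorem det_one_add_vecMulVec_of_disjoint {v c : Fin n → ℂ} (h : ∀ j, v j = 0 ∨ c j = 0) :
    (1 + vecMulVec v c).det = 1 := by
  rw [vecMulVec_eq Unit, det_one_add_replicateCol_mul_replicateRow,
    dotProduct_eq_zero_of_disjoint h, add_zero]

theorem one_add_vecMulVec_neg_mul {v c : Fin n → ℂ} (h : ∀ j, v j = 0 ∨ c j = 0) :
    (1 + vecMulVec (-v) c) * (1 + vecMulVec v c) = 1 := by
  rw [add_mul, mul_add, mul_add, one_mul, one_mul, mul_one, vecMulVec_mul_vecMulVec,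
    dotProduct_eq_zero_of_disjoint h]
  simp

/-- A holomorphic family of matrices on the punctured plane whose first `m` columns are standard
basis vectors and whose determinant is `exp ∘ g`. -/
structure IsReduced (g : ℂ → ℂ) (m : ℕ) (M : ℂ → Matrix (Fin n) (Fin n) ℂ) : Prop where
  holo : ∀ i j, DifferentiableOn ℂ (fun w => M w i j) {0}ᶜ
  det_eq : ∀ w, w ≠ 0 → (M w).det = Complex.exp (g w)
  col : ∀ w, w ≠ 0 → ∀ i j : Fin n, j.1 < m → M w i j = if i = j then 1 else 0

theorem IsReduced.transvection {g : ℂ → ℂ} {m : ℕ} {M : ℂ → Matrix (Fin n) (Fin n) ℂ}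
    (hM : IsReduced g m M) {v c : Fin n → ℂ → ℂ} (hv : ∀ j, DifferentiableOn ℂ (v j) {0}ᶜ)
    (hc : ∀ j, DifferentiableOn ℂ (c j) {0}ᶜ) (hvc : ∀ j, v j = 0 ∨ c j = 0)
    (hcm : ∀ j : Fin n, j.1 < m → c j = 0) :
    IsReduced g m (fun w => (1 + vecMulVec (fun j => v j w) (fun j => c j w)) * M w) where
  holo i j := by
    simp only [one_add_vecMulVec_mul_apply]
    exact (hM.holo i j).add ((hv i).mul (DifferentiableOn.fun_sum fun k _ =>
      (hc k).mul (hM.holo k j)))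
  det_eq w hw := by
    rw [det_mul, det_one_add_vecMulVec_of_disjoint, one_mul, hM.det_eq w hw]
    exact fun j => (hvc j).imp (fun h => by simp [h]) fun h => by simp [h]
  col w hw i j hj := by
    rw [one_add_vecMulVec_mul_apply, Finset.sum_eq_zero, mul_zero, add_zero, hM.col w hw i j hj]
    intro k _
    by_cases hk : k = j
    · simp [hk, hcm j hj]
    · simp [hM.col w hw k j hj, hk]

theorem IsReduced.exists_ne_zero {g : ℂ → ℂ} {m : ℕ} {M : ℂ → Matrix (Fin n) (Fin n) ℂ}
    (hM : IsReduced g m M) {w : ℂ} (hw : w ≠ 0) (k : Fin n) (hk : k.1 = m) :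
    ∃ i : Fin n, m ≤ i.1 ∧ M w i k ≠ 0 := by
  by_contra hcon
  push Not at hcon
  have hdet : (M w).det ≠ 0 := by
    rw [hM.det_eq w hw]
    exact Complex.exp_ne_zero _
  apply hdet
  rw [← exists_mulVec_eq_zero_iff]
  refine ⟨fun j => (if j = k then 1 else 0) - if j.1 < m then M w j k else 0, fun h => ?_, ?_⟩
  · have := congrFun h k
    simp [hk] at this
  · ext i
    simp only [mulVec, dotProduct, mul_sub, mul_ite, mul_one, mul_zero, Finset.sum_sub_distrib,
      Finset.sum_ite_eq', Finset.mem_univ, if_true, Pi.zero_apply]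
    have : ∀ j : Fin n, (if j.1 < m then M w i j * M w j k else 0) =
        if i = j then (if i.1 < m then M w i k else 0) else 0 := by
      intro j
      by_cases hj : j.1 < m
      · rw [if_pos hj, hM.col w hw i j hj]
        by_cases hij : i = j
        · subst hij; simp [hj]
        · simp [hij]
      · rw [if_neg hj]
        by_cases hij : i = j
        · subst hij; simp [hj]
        · simp [hij]
    simp only [this, Finset.sum_ite_eq, Finset.mem_univ, if_true]
    by_cases hi : i.1 < m
    · simp [hi]
    · simp [hi, hcon i (not_lt.1 hi)]

/-- Holomorphic families of matrices on the punctured plane whose determinant has a holomorphic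
logarithm are products of elementary families. -/
theorem matrix_family_induction {P : (ℂ → Matrix (Fin n) (Fin n) ℂ) → Prop}
    (hcongr : ∀ M M', (∀ w, w ≠ 0 → M w = M' w) → P M → P M')
    (hmul : ∀ M M', P M → P M' → P (fun w => M w * M' w))
    (helem : ∀ v c : Fin n → ℂ → ℂ, (∀ j, DifferentiableOn ℂ (v j) {0}ᶜ) →
      (∀ j, DifferentiableOn ℂ (c j) {0}ᶜ) → (∀ j, v j = 0 ∨ c j = 0) →
      P (fun w => 1 + vecMulVec (fun j => v j w) (fun j => c j w)))
    (hdiag : ∀ (l : Fin n) (g : ℂ → ℂ), DifferentiableOn ℂ g {0}ᶜ →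
      P (fun w => diagonal (Function.update 1 l (Complex.exp (g w)))))
    {g : ℂ → ℂ} (hg : DifferentiableOn ℂ g {0}ᶜ) {M : ℂ → Matrix (Fin n) (Fin n) ℂ}
    (hM : ∀ i j, DifferentiableOn ℂ (fun w => M w i j) {0}ᶜ)
    (hdet : ∀ w, w ≠ 0 → (M w).det = Complex.exp (g w)) : P M := by
  have hstep : ∀ v c : Fin n → ℂ → ℂ, (∀ j, DifferentiableOn ℂ (v j) {0}ᶜ) →
      (∀ j, DifferentiableOn ℂ (c j) {0}ᶜ) → (∀ j, v j = 0 ∨ c j = 0) →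
      ∀ M : ℂ → Matrix (Fin n) (Fin n) ℂ,
      P (fun w => (1 + vecMulVec (fun j => v j w) (fun j => c j w)) * M w) → P M := by
    intro v c hv hc hvc M hPM
    have h1 := helem (fun j w => -v j w) c (fun j => (hv j).neg) hc
      fun j => (hvc j).imp_left fun h => by ext; simp [h]
    refine hcongr _ _ (fun w hw => ?_) (hmul _ _ h1 hPM)
    rw [← mul_assoc]
    have := one_add_vecMulVec_neg_mul (v := fun j => v j w) (c := fun j => c j w)
      fun j => (hvc j).imp (fun h => by simp [h]) fun h => by simp [h]
    rw [show (fun j => -v j w) = -fun j => v j w from rfl, this, one_mul]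
  have hconst : ∀ (i : Fin n) (j : Fin n), DifferentiableOn ℂ
      ((Pi.single i (1 : ℂ → ℂ) : Fin n → ℂ → ℂ) j) {0}ᶜ := by
    intro i j
    by_cases h : j = i
    · subst h; simp
    · simp [h]
  have hsum : ∀ (i : Fin n) (w : ℂ) (f : Fin n → ℂ),
      ∑ k, (Pi.single i (1 : ℂ → ℂ) : Fin n → ℂ → ℂ) k w * f k = f i := by
    intro i w f
    rw [Finset.sum_eq_single i]
    · simp
    · intro k _ hk; simp [hk]
    · simp
  suffices h : ∀ r m, m + r = n → ∀ M, IsReduced g m M → P M from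
    h n 0 (zero_add n) M ⟨hM, hdet, fun w _ i j hj => absurd hj (Nat.not_lt_zero _)⟩
  intro r
  induction r with
  | zero =>
    intro m hm M hM
    refine hcongr _ _ (fun w hw => ?_) (helem 0 0 (fun j => differentiableOn_const (0 : ℂ))
      (fun j => differentiableOn_const (0 : ℂ)) fun j => Or.inl rfl)
    ext i j
    rw [hM.col w hw i j (by omega)]
    simp [vecMulVec_apply, one_apply]
  | succ r ih =>
    intro m hm M hM
    by_cases hr : r = 0
    · -- only the last column is left
      let k : Fin n := ⟨m, by omega⟩
      have hlt : ∀ j : Fin n, j ≠ k → j.1 < m := fun j hj => by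
        have : j.1 ≠ m := fun h => hj (Fin.ext h)
        omega
      have hkk : ∀ w, w ≠ 0 → M w k k = Complex.exp (g w) := by
        intro w hw
        rw [← hM.det_eq w hw, det_of_isUpperTriangular, Finset.prod_eq_single k]
        · intro j _ hj
          rw [hM.col w hw j j (hlt j hj), if_pos rfl]
        · simp
        · intro i j hij
          have hij' : j < i := hij
          have hjk : j ≠ k := by
            rintro rfl
            have := i.2
            simp only [k, Fin.lt_def] at hij'
            omega
          rw [hM.col w hw i j (hlt j hjk), if_neg hij'.ne']
      have h1 := helem (fun i w => if i = k then 0 else M w i k * Complex.exp (-g w))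
        (Pi.single k 1)
        (fun i => by
          by_cases hi : i = k
          · simp [hi]
          · simp only [hi, if_false]
            exact (hM.holo i k).mul hg.neg.cexp)
        (hconst k)
        (fun i => by
          by_cases hi : i = k
          · left; ext; simp [hi]
          · right; simp [hi])
      refine hcongr _ _ (fun w hw => ?_) (hmul _ _ h1 (hdiag k g hg))
      ext i j
      rw [one_add_vecMulVec_mul_apply, hsum]
      by_cases hj : j = k
      · rw [hj]
        by_cases hi : i = k
        · rw [hi, hkk w hw]; simp
        · simp only [hi, if_false, diagonal_apply, Function.update_self, if_true, zero_add]
          rw [mul_assoc, ← Complex.exp_add, neg_add_cancel, Complex.exp_zero, mul_one]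
      · rw [hM.col w hw i j (hlt j hj)]
        by_cases hij : i = j
        · subst hij
          simp [hj, Ne.symm hj]
        · simp [hij, Ne.symm hj]
    · let k : Fin n := ⟨m, by omega⟩
      let k' : Fin n := ⟨m + 1, by omega⟩
      have hkk' : k ≠ k' := fun h => by simp [k, k', Fin.ext_iff] at h
      obtain ⟨c, hc, hcs, hc0⟩ := exists_add_sum_mul_ne_zero
        (Finset.univ.filter fun i : Fin n => m ≤ i.1 ∧ i ≠ k') k'
        (f := fun i w => M w i k) (fun i => hM.holo i k) (by
          intro w hw h0
          obtain ⟨i, hi, hi0⟩ := hM.exists_ne_zero hw k rfl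
          have hik : i ≠ k' := fun h => hi0 (h ▸ h0)
          exact ⟨i, by simp [hi, hik], hi0⟩)
      have hd₁ : ∀ j, (Pi.single k' (1 : ℂ → ℂ) : Fin n → ℂ → ℂ) j = 0 ∨ c j = 0 := by
        intro j
        by_cases hj : j = k'
        · right; exact hcs j (by simp [hj])
        · left; simp [hj]
      have hM₁ := hM.transvection (hconst k') hc hd₁ fun j hj => hcs j (by simp [hj])
      refine hstep _ _ (hconst k') hc hd₁ _ ?_
      set M₁ : ℂ → Matrix (Fin n) (Fin n) ℂ := fun w => (1 + vecMulVec
        (fun j => (Pi.single k' (1 : ℂ → ℂ) : Fin n → ℂ → ℂ) j w) fun j => c j w) * M w with hM₁e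
      have hne : ∀ w, w ≠ 0 → M₁ w k' k ≠ 0 := by
        intro w hw
        rw [hM₁e]
        dsimp only
        rw [one_add_vecMulVec_mul_apply]
        simpa using hc0 w hw
      clear_value M₁
      let v₂ : Fin n → ℂ → ℂ := fun i w =>
        if i = k' then 0 else ((if i = k then 1 else 0) - M₁ w i k) / M₁ w k' k
      have hv₂ : ∀ i, DifferentiableOn ℂ (v₂ i) {0}ᶜ := by
        intro i
        by_cases hi : i = k'
        · simp [v₂, hi]
        · simp only [v₂, hi, if_false]
          exact ((differentiableOn_const _).sub (hM₁.holo i k)).div (hM₁.holo k' k)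
            fun w hw => hne w hw
      have hd₂ : ∀ j, v₂ j = 0 ∨ (Pi.single k' (1 : ℂ → ℂ) : Fin n → ℂ → ℂ) j = 0 := by
        intro j
        by_cases hj : j = k'
        · left; ext; simp [v₂, hj]
        · right; simp [hj]
      have hM₂ := hM₁.transvection hv₂ (hconst k') hd₂ fun j hj => by
        have : j ≠ k' := by rintro rfl; simp [k'] at hj
        simp [this]
      refine hstep _ _ hv₂ (hconst k') hd₂ _ ?_
      set M₂ : ℂ → Matrix (Fin n) (Fin n) ℂ := fun w => (1 + vecMulVec
        (fun j => v₂ j w) fun j => (Pi.single k' (1 : ℂ → ℂ) : Fin n → ℂ → ℂ) j w) * M₁ w with hM₂e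
      have hcol : ∀ w, w ≠ 0 → ∀ i, i ≠ k' → M₂ w i k = if i = k then 1 else 0 := by
        intro w hw i hi
        rw [hM₂e]
        dsimp only
        rw [one_add_vecMulVec_mul_apply, hsum]
        simp only [v₂, hi, if_false]
        rw [div_mul_cancel₀ _ (hne w hw)]
        ring
      clear_value M₂
      let v₃ : Fin n → ℂ → ℂ := fun i w => if i = k' then -M₂ w k' k else 0
      have hv₃ : ∀ i, DifferentiableOn ℂ (v₃ i) {0}ᶜ := by
        intro i
        by_cases hi : i = k'
        · simp only [v₃, hi, if_true]
          exact (hM₂.holo k' k).neg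
        · simp [v₃, hi]
      have hd₃ : ∀ j, v₃ j = 0 ∨ (Pi.single k (1 : ℂ → ℂ) : Fin n → ℂ → ℂ) j = 0 := by
        intro j
        by_cases hj : j = k'
        · right; simp [hj, hkk'.symm]
        · left; ext; simp [v₃, hj]
      have hM₃ := hM₂.transvection hv₃ (hconst k) hd₃ fun j hj => by
        have : j ≠ k := by rintro rfl; simp [k] at hj
        simp [this]
      refine hstep _ _ hv₃ (hconst k) hd₃ _ (ih (m + 1) (by omega) _
        ⟨hM₃.holo, hM₃.det_eq, fun w hw i j hj => ?_⟩)
      rcases Nat.lt_succ_iff_lt_or_eq.1 hj with hj | hj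
      · exact hM₃.col w hw i j hj
      · have hjk : j = k := Fin.ext hj
        rw [hjk, one_add_vecMulVec_mul_apply, hsum, hcol w hw k hkk', if_pos rfl, mul_one]
        by_cases hi : i = k'
        · simp [v₃, hi, hkk'.symm]
        · simp [v₃, hi, hcol w hw i hi]

end JetInterpolation

namespace JetInterpolation
open Filter Topology Set Matrix

/-- A polynomial equal to one at one of finitely many points and vanishing to order `d` at the
others. -/
theorem exists_polynomial_cutoff {N : ℕ} {a : Fin N → ℂ} (ha : Function.Injective a) (i : Fin N)
    (d : ℕ) : ∃ ρ : Polynomial ℂ, ρ.eval (a i) = 1 ∧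
      ∀ i', i' ≠ i → (Polynomial.X - Polynomial.C (a i')) ^ d ∣ ρ := by
  classical
  refine ⟨Lagrange.basis Finset.univ a i ^ d, ?_, fun i' hi' => pow_dvd_pow_of_dvd ?_ d⟩
  · rw [Polynomial.eval_pow, Lagrange.eval_basis_self ha.injOn (Finset.mem_univ i), one_pow]
  · refine Dvd.dvd.trans ?_ (Finset.dvd_prod_of_mem _
      (Finset.mem_erase.2 ⟨hi', Finset.mem_univ i'⟩))
    exact Dvd.intro_left _ rfl

theorem eval_eq_zero_of_sq_dvd {ρ : Polynomial ℂ} {a : ℂ}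
    (h : (Polynomial.X - Polynomial.C a) ^ 2 ∣ ρ) :
    ρ.eval a = 0 ∧ ρ.derivative.eval a = 0 := by
  obtain ⟨q, rfl⟩ := h
  simp [Polynomial.derivative_mul, Polynomial.derivative_pow]

variable {E : Type*} [NormedAddCommGroup E] [NormedSpace ℂ E] {n : ℕ}

/-- A family of matrices is realized at the point `x i` if it is the family of differentials at
`x i` of a family of automorphisms which fixes all points and is tangent to the identity at the
other points. -/
def IsRealizedAt (b : Module.Basis (Fin n) ℂ E) {N : ℕ} (x : Fin N → E) (i : Fin N)
    (M : ℂ → Matrix (Fin n) (Fin n) ℂ) : Prop :=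
  ∃ F G : ℂ × E → E, IsAutFamily F G ∧ ∀ w, w ≠ 0 → ∀ i', F (w, x i') = x i' ∧
    (fderiv ℂ (fun z => F (w, z)) (x i') : E →ₗ[ℂ] E) = toLin b b (if i' = i then M w else 1)

variable {b : Module.Basis (Fin n) ℂ E} {N : ℕ} {x : Fin N → E} {i : Fin N}

theorem IsRealizedAt.mul {M M' : ℂ → Matrix (Fin n) (Fin n) ℂ} (h : IsRealizedAt b x i M)
    (h' : IsRealizedAt b x i M') : IsRealizedAt b x i (fun w => M w * M' w) := by
  obtain ⟨F, G, hF, hFx⟩ := h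
  obtain ⟨F', G', hF', hFx'⟩ := h'
  refine ⟨_, _, hF.comp hF', fun w hw i' => ⟨?_, ?_⟩⟩
  · simp only [(hFx' w hw i').1, (hFx w hw i').1]
  · rw [hF.fderiv_comp hF' hw, (hFx' w hw i').1, ContinuousLinearMap.toLinearMap_comp,
      (hFx' w hw i').2, (hFx w hw i').2, ← toLin_mul]
    by_cases hi : i' = i <;> simp [hi]

variable [FiniteDimensional ℂ E]

theorem isRealizedAt_elementary (hx : ∀ j, Function.Injective fun i => coordL b j (x i))
    {v c : Fin n → ℂ → ℂ} (hv : ∀ j, DifferentiableOn ℂ (v j) {0}ᶜ)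
    (hc : ∀ j, DifferentiableOn ℂ (c j) {0}ᶜ) (hvc : ∀ j, v j = 0 ∨ c j = 0) :
    IsRealizedAt b x i (fun w => 1 + vecMulVec (fun j => v j w) (fun j => c j w)) := by
  choose ρ hρ1 hρ using fun j => exists_polynomial_cutoff (hx j) i 2
  let q : Fin n → Polynomial ℂ := fun j =>
    (Polynomial.X - Polynomial.C (coordL b j (x i))) * ρ j
  have hq0 : ∀ j i', (q j).eval (coordL b j (x i')) = 0 := by
    intro j i'
    by_cases hi : i' = i
    · simp [q, hi]
    · simp [q, (eval_eq_zero_of_sq_dvd (hρ j i' hi)).1]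
  have hq1 : ∀ j i', (q j).derivative.eval (coordL b j (x i')) = if i' = i then 1 else 0 := by
    intro j i'
    by_cases hi : i' = i
    · simp [q, hi, Polynomial.derivative_mul, hρ1]
    · simp [q, hi, Polynomial.derivative_mul, (eval_eq_zero_of_sq_dvd (hρ j i' hi)).1,
        (eval_eq_zero_of_sq_dvd (hρ j i' hi)).2]
  have hA := IsAutFamily.shear (E := E)
    (f := fun p => (∑ j, c j p.1 * (q j).eval (coordL b j p.2)) • ∑ k, v k p.1 • b k)
    (fun w z hw => (Finset.analyticAt_fun_sum _ fun j _ =>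
      ((analyticAt_of_punctured (hc j) hw).fun_comp_of_eq analyticAt_fst rfl).mul
        ((AnalyticAt.aeval_polynomial analyticAt_id (q j)).fun_comp
          (analyticAt_coordL_snd b j _))).smul
      (Finset.analyticAt_fun_sum _ fun k _ =>
        ((analyticAt_of_punctured (hv k) hw).fun_comp_of_eq analyticAt_fst rfl).smul
          analyticAt_const))
    (fun w z z' hw => by
      dsimp only
      congr 1
      refine Finset.sum_congr rfl fun j _ => ?_
      rcases hvc j with h | h
      · have : coordL b j (∑ k, v k w • b k) = 0 := by
          simp [coordL_self, h]
        rw [map_add, map_smul, this, smul_zero, add_zero]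
      · simp [h])
  refine ⟨_, _, hA, fun w hw i' => ⟨by simp [hq0], ?_⟩⟩
  have hder : HasFDerivAt (fun z => z + (∑ j, c j w * (q j).eval (coordL b j z)) •
      ∑ k, v k w • b k) (ContinuousLinearMap.id ℂ E +
        (∑ j, c j w • ((q j).derivative.eval (coordL b j (x i')) • coordL b j)).smulRight
          (∑ k, v k w • b k)) (x i') := by
    refine (hasFDerivAt_id _).add (HasFDerivAt.smul_const (HasFDerivAt.fun_sum fun j _ => ?_) _)
    exact (((q j).hasDerivAt _).comp_hasFDerivAt _ (coordL b j).hasFDerivAt).const_mul (c j w)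
  rw [hder.fderiv]
  refine b.ext fun k => ?_
  simp only [hq1]
  rw [toLin_self]
  by_cases hi : i' = i
  · simp [hi, coordL_self, add_smul, one_apply, vecMulVec_apply, Finset.sum_add_distrib,
      Finset.smul_sum, smul_smul, mul_comm]
  · simp [hi, one_apply]

theorem isRealizedAt_diagonal (hx : ∀ j, Function.Injective fun i => coordL b j (x i))
    {o l : Fin n} (hol : o ≠ l) {g : ℂ → ℂ} (hg : DifferentiableOn ℂ g {0}ᶜ) :
    IsRealizedAt b x i (fun w => diagonal (Function.update 1 l (Complex.exp (g w)))) := by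
  obtain ⟨ρ, hρ1, hρ⟩ := exists_polynomial_cutoff (hx o) i 2
  have hA := IsAutFamily.overshear (E := E)
    (η := fun p => g p.1 * ρ.eval (coordL b o p.2)) (v := b l)
    (fun w z hw => ((analyticAt_of_punctured hg hw).fun_comp_of_eq analyticAt_fst rfl).mul
      ((AnalyticAt.aeval_polynomial analyticAt_id ρ).fun_comp (analyticAt_coordL_snd b o _)))
    (fun w z t hw => by simp [coordL_of_ne b hol.symm])
    (coordL b l) (coordL_same b l) (x i)
  have hval : ∀ w i', (Complex.exp (g w * ρ.eval (coordL b o (x i'))) - 1) =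
      if i' = i then Complex.exp (g w) - 1 else 0 := by
    intro w i'
    by_cases hi : i' = i
    · simp [hi, hρ1]
    · simp [hi, (eval_eq_zero_of_sq_dvd (hρ i' hi)).1]
  refine ⟨_, _, hA, fun w hw i' => ⟨?_, ?_⟩⟩
  · simp only [hval]
    by_cases hi : i' = i <;> simp [hi]
  · have hder : HasFDerivAt (fun z => z + ((Complex.exp (g w * ρ.eval (coordL b o z)) - 1) *
        coordL b l (z - x i)) • b l) (ContinuousLinearMap.id ℂ E +
        ((Complex.exp (g w * ρ.eval (coordL b o (x i'))) - 1) • coordL b l +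
          coordL b l (x i' - x i) • (Complex.exp (g w * ρ.eval (coordL b o (x i'))) •
            (g w • (ρ.derivative.eval (coordL b o (x i')) • coordL b o)))).smulRight (b l))
        (x i') := by
      have h1 := ((((ρ.hasDerivAt _).comp_hasFDerivAt _ (coordL b o).hasFDerivAt).const_mul
        (g w)).cexp).sub_const (1 : ℂ) (x := x i')
      have h2 := ((coordL b l).hasFDerivAt (x := x i' - x i)).comp (x i')
        ((hasFDerivAt_id (x i')).sub_const (x i))
      exact (hasFDerivAt_id _).add ((h1.mul h2).smul_const (b l))
    rw [hder.fderiv]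
    refine b.ext fun k => ?_
    rw [toLin_self, hval]
    by_cases hi : i' = i
    · simp only [hi, if_true, sub_self, map_zero]
      by_cases hk : k = l
      · subst hk
        simp [coordL_same, diagonal_apply, sub_smul]
      · simp [coordL_of_ne b hk, diagonal_apply, hk]
    · simp [hi, (eval_eq_zero_of_sq_dvd (hρ i' hi)).2, one_apply]

/-- Prescribing the differentials at finitely many fixed points. -/
theorem exists_autFamily_fderiv (hn : 2 ≤ n)
    (hx : ∀ j, Function.Injective fun i => coordL b j (x i))
    {M : Fin N → ℂ → Matrix (Fin n) (Fin n) ℂ}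
    (hM : ∀ i k l, DifferentiableOn ℂ (fun w => M i w k l) {0}ᶜ) {g : Fin N → ℂ → ℂ}
    (hg : ∀ i, DifferentiableOn ℂ (g i) {0}ᶜ)
    (hdet : ∀ i w, w ≠ 0 → (M i w).det = Complex.exp (g i w)) :
    ∃ F G : ℂ × E → E, IsAutFamily F G ∧ ∀ w, w ≠ 0 → ∀ i, F (w, x i) = x i ∧
      (fderiv ℂ (fun z => F (w, z)) (x i) : E →ₗ[ℂ] E) = toLin b b (M i w) := by
  have hreal : ∀ i, IsRealizedAt b x i (M i) := fun i =>
    matrix_family_induction (P := IsRealizedAt b x i)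
      (fun M M' h hM => by
        obtain ⟨F, G, hF, hFx⟩ := hM
        exact ⟨F, G, hF, fun w hw i' => by rw [← h w hw]; exact hFx w hw i'⟩)
      (fun M M' h h' => h.mul h') (fun v c hv hc hvc => isRealizedAt_elementary hx hv hc hvc)
      (fun l g hg => by
        have : Nontrivial (Fin n) := Fin.nontrivial_iff_two_le.2 hn
        obtain ⟨o, ho⟩ := exists_ne l
        exact isRealizedAt_diagonal hx ho hg) (hg i) (hM i) (hdet i)
  suffices h : ∀ S : Finset (Fin N), ∃ F G : ℂ × E → E, IsAutFamily F G ∧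
      ∀ w, w ≠ 0 → ∀ i, F (w, x i) = x i ∧ (fderiv ℂ (fun z => F (w, z)) (x i) : E →ₗ[ℂ] E) =
        toLin b b (if i ∈ S then M i w else 1) by
    obtain ⟨F, G, hF, h⟩ := h Finset.univ
    exact ⟨F, G, hF, fun w hw i => by simpa using h w hw i⟩
  intro S
  induction S using Finset.induction_on with
  | empty =>
    refine ⟨_, _, IsAutFamily.id, fun w hw i => ⟨rfl, ?_⟩⟩
    simp
  | insert m S hm ih =>
    obtain ⟨F, G, hF, hFx⟩ := ih
    obtain ⟨F', G', hF', hFx'⟩ := hreal m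
    refine ⟨_, _, hF.comp hF', fun w hw i' => ⟨?_, ?_⟩⟩
    · simp only [(hFx' w hw i').1, (hFx w hw i').1]
    · rw [hF.fderiv_comp hF' hw, (hFx' w hw i').1, ContinuousLinearMap.toLinearMap_comp,
        (hFx' w hw i').2, (hFx w hw i').2, ← toLin_mul]
      by_cases hi : i' = m
      · subst hi; simp [hm]
      · simp [hi]

end JetInterpolation

namespace JetInterpolation
open Filter Topology Set Asymptotics

theorem isBigO_norm_pow_of_le {V : Type*} [NormedAddCommGroup V] {d e : ℕ} (h : d ≤ e) :
    (fun u : V => ‖u‖ ^ e) =O[𝓝 0] fun u => ‖u‖ ^ d := by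
  obtain ⟨m, rfl⟩ := Nat.exists_eq_add_of_le h
  have : (fun u : V => ‖u‖ ^ m) =O[𝓝 0] fun _ => (1 : ℝ) :=
    ((continuous_norm.pow m).tendsto (0 : V)).isBigO_one ℝ
  simpa [pow_add] using (isBigO_refl (fun u : V => ‖u‖ ^ d) (𝓝 0)).mul this

variable {E : Type*} [NormedAddCommGroup E] [NormedSpace ℂ E]
  {E' : Type*} [NormedAddCommGroup E'] [NormedSpace ℂ E']

theorem isBigO_continuousLinearMap_norm (T : E →L[ℂ] E') :
    (fun u => T u) =O[𝓝 0] fun u : E => ‖u‖ :=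
  (T.isBigO_id _).norm_right

/-- Changing the argument of an analytic map by a small perturbation of order `d`. -/
theorem isBigO_comp_perturbation {Φ : E → E'} {y : E} (hΦ : AnalyticAt ℂ Φ y) {ψ : E → E} {d : ℕ}
    (hd : 1 ≤ d) (hψ : (fun u => ψ u - u) =O[𝓝 0] fun u => ‖u‖ ^ d) :
    (fun u => Φ (y + ψ u) - Φ (y + u) - fderiv ℂ Φ y (ψ u - u)) =O[𝓝 0]
      fun u => ‖u‖ ^ (d + 1) := by
  obtain ⟨p, hp⟩ := hΦ
  have hψ1 : (fun u => ψ u - u) =O[𝓝 0] fun u : E => ‖u‖ := by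
    simpa using hψ.trans (isBigO_norm_pow_of_le hd)
  have hψ0 : ψ =O[𝓝 0] fun u : E => ‖u‖ := by
    simpa using hψ1.add (isBigO_continuousLinearMap_norm (ContinuousLinearMap.id ℂ E))
  have hlim : Tendsto ψ (𝓝 0) (𝓝 0) :=
    hψ0.trans_tendsto (by simpa using (continuous_norm (E := E)).tendsto 0)
  have hpair : Tendsto (fun u => (y + ψ u, y + u)) (𝓝 0) (𝓝 (y, y)) := by
    refine Tendsto.prodMk_nhds ?_ ?_
    · simpa using hlim.const_add y
    · simpa using (tendsto_id (α := E) (x := 𝓝 0)).const_add y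
  have h := (hp.isBigO_image_sub_norm_mul_norm_sub).comp_tendsto hpair
  have hfd : ∀ v, fderiv ℂ Φ y v = p 1 fun _ => v := fun v => by
    rw [hp.fderiv_eq]
    rfl
  simp only [hfd]
  refine IsBigO.trans (by simpa [Function.comp_def] using h) ?_
  have hn : (fun u => ‖(ψ u, u)‖) =O[𝓝 0] fun u : E => ‖u‖ :=
    (hψ0.prod_left (isBigO_refl (fun u : E => u) _).norm_right).norm_left
  refine (hn.mul hψ.norm_left).congr_right fun u => ?_
  rw [pow_succ, mul_comm]

/-- An analytic map vanishing to order `d + 1` has zero derivatives up to order `d`. -/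
theorem iteratedFDeriv_eq_zero_of_isBigO [CompleteSpace E'] {h : E → E'}
    (hh : AnalyticAt ℂ h 0) {d : ℕ} (hO : h =O[𝓝 0] fun u => ‖u‖ ^ (d + 1)) {j : ℕ} (hj : j ≤ d) :
    iteratedFDeriv ℂ j h 0 = 0 := by
  obtain ⟨p, hp⟩ := hh
  have hdiag : ∀ j, j ≤ d → ∀ u, (p j fun _ => u) = 0 := by
    intro j
    induction j using Nat.strong_induction_on with
    | _ j ih =>
      intro hj
      have h1 := hp.isBigO_sub_partialSum_pow (j + 1)
      simp only [zero_add] at h1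
      have h2 : h =O[𝓝 0] fun u => ‖u‖ ^ (j + 1) :=
        hO.trans (isBigO_norm_pow_of_le (by omega))
      have h3 : ∀ u, p.partialSum (j + 1) u = p j fun _ => u := by
        intro u
        rw [FormalMultilinearSeries.partialSum, Finset.sum_range_succ, Finset.sum_eq_zero, zero_add]
        intro k hk
        have hk' := Finset.mem_range.1 hk
        exact ih k hk' (by omega) u
      have h4 : (fun u => p j fun _ => u) =O[𝓝 0] fun u : E => ‖u‖ ^ (j + 1) := by
        refine (h2.sub h1).congr_left fun u => ?_
        rw [h3]
        abel
      exact h4.continuousMultilinearMap_apply_eq_zero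
  ext v
  obtain ⟨r, hr⟩ := hp
  rw [hr.iteratedFDeriv_eq_sum_of_completeSpace,
    ← ContinuousMultilinearMap.iteratedFDeriv_comp_diagonal (p j) 0 v]
  simp only [hdiag j hj]
  simp

theorem iteratedFDeriv_diagonal_of_symm {d : ℕ} (f : E [×d]→L[ℂ] E')
    (hf : ∀ (σ : Equiv.Perm (Fin d)) v, f (v ∘ σ) = f v) :
    iteratedFDeriv ℂ d (fun u => f fun _ => u) 0 = (d.factorial : ℂ) • f := by
  ext v
  rw [f.iteratedFDeriv_comp_diagonal]
  have : ∀ σ : Equiv.Perm (Fin d), (f fun i => v (σ i)) = f v := fun σ => hf σ v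
  simp [this, Fintype.card_perm, Nat.cast_smul_eq_nsmul]

theorem isBigO_diagonal {d : ℕ} (f : E [×d]→L[ℂ] E') :
    (fun u => f fun _ => u) =O[𝓝 0] fun u : E => ‖u‖ ^ d :=
  IsBigO.of_bound ‖f‖ (Eventually.of_forall fun u => by
    simpa using f.le_opNorm fun _ => u)

theorem analyticAt_clm_comp_const {V V' : Type*} [NormedAddCommGroup V] [NormedSpace ℂ V]
    [NormedAddCommGroup V'] [NormedSpace ℂ V'] {g : V → V →L[ℂ] V'} {q : V}
    (hg : AnalyticAt ℂ g q) (T : E →L[ℂ] V) : AnalyticAt ℂ (fun q => (g q).comp T) q :=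
  (((ContinuousLinearMap.compL ℂ E V V').flip T).analyticAt (g q)).fun_comp hg

/-- Derivatives along the fibres of an analytic family are analytic. -/
theorem analyticAt_iteratedFDeriv_slice [CompleteSpace E'] {F : ℂ × E → E'}
    (hF : ∀ w z, w ≠ 0 → AnalyticAt ℂ F (w, z)) (m : ℕ) :
    ∀ w z, w ≠ 0 →
      AnalyticAt ℂ (fun q : ℂ × E => iteratedFDeriv ℂ m (fun z => F (q.1, z)) q.2) (w, z) := by
  induction m with
  | zero =>
    intro w z hw
    simp only [iteratedFDeriv_zero_eq_comp, Function.comp_apply]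
    exact ((continuousMultilinearCurryFin0 ℂ E E').symm.toContinuousLinearEquiv
      |>.toContinuousLinearMap.analyticAt _).fun_comp (hF w z hw)
  | succ m ih =>
    intro w z hw
    let K : ℂ × E → E [×m]→L[ℂ] E' := fun q => iteratedFDeriv ℂ m (fun z => F (q.1, z)) q.2
    have hK : ∀ q : ℂ × E, q.1 ≠ 0 → fderiv ℂ (fun z => K (q.1, z)) q.2 =
        (fderiv ℂ K q).comp (ContinuousLinearMap.inr ℂ ℂ E) := by
      intro q hq
      have h1 : HasFDerivAt K (fderiv ℂ K q) (q.1, q.2) :=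
        (ih q.1 q.2 hq).differentiableAt.hasFDerivAt
      exact (h1.comp q.2 (hasFDerivAt_prodMk_right q.1 q.2)).fderiv
    have hev : ∀ᶠ q : ℂ × E in 𝓝 (w, z), q.1 ≠ 0 :=
      continuous_fst.continuousAt.eventually_ne hw
    have h2 : AnalyticAt ℂ (fun q => (fderiv ℂ K q).comp (ContinuousLinearMap.inr ℂ ℂ E))
        (w, z) :=
      analyticAt_clm_comp_const (ih w z hw).fderiv _
    have h3 : AnalyticAt ℂ (fun q : ℂ × E => fderiv ℂ (fun z => K (q.1, z)) q.2) (w, z) :=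
      h2.congr (hev.mono fun q hq => (hK q hq).symm)
    exact ((continuousMultilinearCurryLeftEquiv ℂ (fun _ : Fin (m + 1) => E)
      E').symm.toContinuousLinearEquiv.toContinuousLinearMap.analyticAt _).fun_comp h3

theorem analyticAt_fderiv_slice [CompleteSpace E'] {F : ℂ × E → E'}
    (hF : ∀ w z, w ≠ 0 → AnalyticAt ℂ F (w, z)) (w : ℂ) (z : E) (hw : w ≠ 0) :
    AnalyticAt ℂ (fun q : ℂ × E => fderiv ℂ (fun z => F (q.1, z)) q.2) (w, z) := by
  have h := analyticAt_iteratedFDeriv_slice hF 1 w z hw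
  have h' := ((continuousMultilinearCurryFin1 ℂ E
    E').toContinuousLinearEquiv.toContinuousLinearMap.analyticAt _).fun_comp h
  refine h'.congr (Eventually.of_forall fun q => ?_)
  ext v
  simp

end JetInterpolation

namespace JetInterpolation
open Filter Topology Set Asymptotics

theorem isBigO_exp_sub_one {V : Type*} [NormedAddCommGroup V] {f : V → ℂ} {m : ℕ} (hm : 1 ≤ m)
    (hf : f =O[𝓝 0] fun u => ‖u‖ ^ m) :
    (fun u => Complex.exp (f u) - 1) =O[𝓝 0] (fun u => ‖u‖ ^ m) ∧
    (fun u => Complex.exp (f u) - 1 - f u) =O[𝓝 0] fun u => ‖u‖ ^ (m + 1) := by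
  have hlim : Tendsto f (𝓝 0) (𝓝 0) := hf.trans_tendsto (by
    simpa [show m ≠ 0 by omega] using
      (by fun_prop : Continuous fun u : V => ‖u‖ ^ m).tendsto 0)
  have hev : ∀ᶠ u in 𝓝 (0 : V), ‖f u‖ ≤ 1 :=
    (hlim.norm.eventually (ge_mem_nhds (by simp)))
  constructor
  · exact (IsBigO.of_bound 2 (hev.mono fun u hu => Complex.norm_exp_sub_one_le hu)).trans hf
  · have h2 : (fun u => f u ^ 2) =O[𝓝 0] fun u => ‖u‖ ^ (m + 1) := by
      refine (hf.pow 2).trans ?_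
      simp only [← pow_mul]
      exact isBigO_norm_pow_of_le (by omega)
    refine (IsBigO.of_bound 1 (hev.mono fun u hu => ?_)).trans h2
    simpa using Complex.norm_exp_sub_one_sub_id_le hu

variable {E : Type*} [NormedAddCommGroup E] [NormedSpace ℂ E] {N d : ℕ} {x : Fin N → E}

/-- A family `β` of maps of order `d` which is the leading perturbation, at each of the points
`x i`, of a holomorphic family of automorphisms tangent to the identity at these points. -/
structure IsTangentJet (x : Fin N → E) (d : ℕ) (β : Fin N → ℂ → E → E) : Prop where
  isBigO : ∀ i w, w ≠ 0 → β i w =O[𝓝 0] fun u => ‖u‖ ^ d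
  exists_autFamily : ∃ F G, IsAutFamily F G ∧ ∀ i w, w ≠ 0 →
    (fun u => F (w, x i + u) - x i - u - β i w u) =O[𝓝 0] fun u => ‖u‖ ^ (d + 1)

theorem fderiv_eq_id_of_isBigO {Φ : E → E} {y : E} (hΦ : DifferentiableAt ℂ Φ y) (hd : 2 ≤ d)
    (h : (fun u => Φ (y + u) - y - u) =O[𝓝 0] fun u => ‖u‖ ^ d) :
    fderiv ℂ Φ y = ContinuousLinearMap.id ℂ E := by
  have h0 : HasFDerivAt (fun u => Φ (y + u) - y - u) (0 : E →L[ℂ] E) 0 :=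
    IsBigO.hasFDerivAt (n := d) (by simpa using h) (by omega)
  have h1 : HasFDerivAt (fun u => Φ (y + u)) (fderiv ℂ Φ y) 0 := by
    have h2 : HasFDerivAt Φ (fderiv ℂ Φ y) (y + 0) := by simpa using hΦ.hasFDerivAt
    simpa [Function.comp_def] using h2.comp (0 : E) ((hasFDerivAt_id (0 : E)).const_add y)
  have h3 := ((h1.sub_const y).sub (hasFDerivAt_id (0 : E))).unique h0
  exact sub_eq_zero.1 h3

namespace IsTangentJet

variable {β β₁ β₂ : Fin N → ℂ → E → E}

theorem congr (h : IsTangentJet x d β₁) (hβ : ∀ i w, w ≠ 0 → β₁ i w = β₂ i w) :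
    IsTangentJet x d β₂ := by
  refine ⟨fun i w hw => hβ i w hw ▸ h.isBigO i w hw, ?_⟩
  obtain ⟨F, G, hF, h⟩ := h.exists_autFamily
  exact ⟨F, G, hF, fun i w hw => hβ i w hw ▸ h i w hw⟩

theorem zero : IsTangentJet x d fun _ _ _ => 0 :=
  ⟨fun _ _ _ => isBigO_zero _ _, _, _, IsAutFamily.id, fun i w hw => by
    simpa using isBigO_zero _ _⟩

theorem add (hd : 2 ≤ d) (h₁ : IsTangentJet x d β₁) (h₂ : IsTangentJet x d β₂) :
    IsTangentJet x d fun i w u => β₁ i w u + β₂ i w u := by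
  refine ⟨fun i w hw => (h₁.isBigO i w hw).add (h₂.isBigO i w hw), ?_⟩
  obtain ⟨F₁, G₁, hF₁, hβ₁⟩ := h₁.exists_autFamily
  obtain ⟨F₂, G₂, hF₂, hβ₂⟩ := h₂.exists_autFamily
  refine ⟨_, _, hF₁.comp hF₂, fun i w hw => ?_⟩
  have hO₁ : (fun u => F₁ (w, x i + u) - x i - u) =O[𝓝 0] fun u => ‖u‖ ^ d := by
    simpa using ((hβ₁ i w hw).trans (isBigO_norm_pow_of_le d.le_succ)).add (h₁.isBigO i w hw)
  have hO₂ : (fun u => F₂ (w, x i + u) - x i - u) =O[𝓝 0] fun u => ‖u‖ ^ d := by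
    simpa using ((hβ₂ i w hw).trans (isBigO_norm_pow_of_le d.le_succ)).add (h₂.isBigO i w hw)
  have hΦ := hF₁.analyticAt_slice hw (x i)
  have hid := fderiv_eq_id_of_isBigO hΦ.differentiableAt hd hO₁
  have hp := isBigO_comp_perturbation hΦ (ψ := fun u => F₂ (w, x i + u) - x i) (by omega) hO₂
  rw [hid] at hp
  refine ((hp.add (hβ₁ i w hw)).add (hβ₂ i w hw)).congr_left fun u => ?_
  simp only [add_sub_cancel, ContinuousLinearMap.id_apply]
  abel

theorem sum {ι : Type*} (hd : 2 ≤ d) (s : Finset ι) {β : ι → Fin N → ℂ → E → E}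
    (h : ∀ a ∈ s, IsTangentJet x d (β a)) :
    IsTangentJet x d fun i w u => ∑ a ∈ s, β a i w u := by
  classical
  induction s using Finset.induction_on with
  | empty => simpa using zero
  | insert a s ha ih =>
    refine ((h a (Finset.mem_insert_self a s)).add hd
      (ih fun c hc => h c (Finset.mem_insert_of_mem hc))).congr fun i w _ => ?_
    ext u
    rw [Finset.sum_insert ha]

end IsTangentJet

/-- The maps which, after multiplication by an arbitrary holomorphic function of the parameter,
are leading perturbations at the point `x i` and do not perturb the other points. -/
def tangentJets (x : Fin N → E) (hd : 2 ≤ d) (i : Fin N) : Submodule ℂ (E → E) where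
  carrier := {β | ∀ c : ℂ → ℂ, DifferentiableOn ℂ c {0}ᶜ →
    IsTangentJet x d fun i' w u => if i' = i then c w • β u else 0}
  add_mem' h h' c hc := ((h c hc).add hd (h' c hc)).congr fun i' w _ => by
    ext u
    split_ifs <;> simp
  zero_mem' c _ := IsTangentJet.zero.congr fun i' w _ => by
    ext u
    simp
  smul_mem' a β h c hc := (h (fun w => c w * a) (hc.mul_const a)).congr fun i' w _ => by
    ext u
    simp [mul_smul]

/-- A polynomial with prescribed leading term `t ^ d` at one of finitely many points, vanishing
to higher order at the others. -/
theorem exists_polynomial_leading {a : Fin N → ℂ} (ha : Function.Injective a) (i : Fin N)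
    (d : ℕ) : ∃ P : Polynomial ℂ,
      (∃ R : Polynomial ℂ, ∀ t, P.eval (a i + t) = t ^ d + t ^ (d + 1) * R.eval t) ∧
      ∀ i', i' ≠ i → ∃ R : Polynomial ℂ, ∀ t, P.eval (a i' + t) = t ^ (d + 2) * R.eval t := by
  obtain ⟨ρ, hρ, hdvd⟩ := exists_polynomial_cutoff ha i (d + 2)
  refine ⟨(Polynomial.X - Polynomial.C (a i)) ^ d * ρ, ?_, fun i' hi' => ?_⟩
  · obtain ⟨R, hR⟩ := Polynomial.dvd_iff_isRoot.2
      (show (ρ - 1).IsRoot (a i) by simp [hρ])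
    refine ⟨R.comp (Polynomial.C (a i) + Polynomial.X), fun t => ?_⟩
    have : ρ.eval (a i + t) = 1 + t * R.eval (a i + t) := by
      have h := congrArg (Polynomial.eval (a i + t)) hR
      simp only [Polynomial.eval_sub, Polynomial.eval_one, Polynomial.eval_mul, Polynomial.eval_X,
        Polynomial.eval_C, add_sub_cancel_left] at h
      rw [← h]
      ring
    simp [this]
    ring
  · obtain ⟨R, hR⟩ := hdvd i' hi'
    refine ⟨((Polynomial.X - Polynomial.C (a i)) ^ d * R).comp
      (Polynomial.C (a i') + Polynomial.X), fun t => ?_⟩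
    simp [hR]
    ring

theorem isBigO_pow_mul_eval (lam : E →L[ℂ] ℂ) (m : ℕ) (R : Polynomial ℂ) :
    (fun u => lam u ^ m * R.eval (lam u)) =O[𝓝 0] fun u => ‖u‖ ^ m := by
  have h1 : (fun u => R.eval (lam u)) =O[𝓝 0] fun _ => (1 : ℝ) :=
    ((R.continuous.comp lam.continuous).tendsto (0 : E)).isBigO_one ℝ
  simpa using ((isBigO_continuousLinearMap_norm lam).pow m).mul h1

theorem pow_smul_mem_tangentJets (hd : 2 ≤ d) (i : Fin N) {lam : E →L[ℂ] ℂ}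
    (hlam : Function.Injective fun i => lam (x i)) {v : E} (hv : lam v = 0) :
    (fun u => lam u ^ d • v) ∈ tangentJets x hd i := by
  intro c hc
  obtain ⟨P, ⟨R, hR⟩, hP⟩ := exists_polynomial_leading hlam i d
  have hO : (fun u => lam u ^ d • v) =O[𝓝 0] fun u => ‖u‖ ^ d := by
    simpa using ((isBigO_continuousLinearMap_norm lam).pow d).smul
      (isBigO_const_const v (one_ne_zero (α := ℝ)) (𝓝 (0 : E)))
  refine ⟨fun i' w hw => ?_, fun q => q.2 + (c q.1 * P.eval (lam q.2)) • v, _,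
    IsAutFamily.shear (fun w z hw => ?_) (fun w z z' hw => ?_), fun i' w hw => ?_⟩
  · split_ifs
    · exact hO.const_smul_left _
    · exact isBigO_zero _ _
  · refine (AnalyticAt.mul ?_ ?_).smul analyticAt_const
    · exact (analyticAt_of_punctured hc hw).fun_comp_of_eq analyticAt_fst rfl
    · exact (AnalyticAt.aeval_polynomial analyticAt_id P).fun_comp
        ((lam.analyticAt _).fun_comp analyticAt_snd)
  · simp [hv]
  · have hs : ∀ g : E → ℂ, g =O[𝓝 0] (fun u => ‖u‖ ^ (d + 1)) →
        (fun u => (c w * g u) • v) =O[𝓝 0] fun u => ‖u‖ ^ (d + 1) := fun g hg => by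
      simpa using (hg.const_mul_left (c w)).smul
        (isBigO_const_const v (one_ne_zero (α := ℝ)) (𝓝 (0 : E)))
    by_cases hi : i' = i
    · subst hi
      refine (hs _ (isBigO_pow_mul_eval lam (d + 1) R)).congr_left fun u => ?_
      simp only [map_add, hR, if_true, mul_add, add_smul, mul_smul]
      abel
    · obtain ⟨R', hR'⟩ := hP i' hi
      refine (hs _ ((isBigO_pow_mul_eval lam (d + 2) R').trans
        (isBigO_norm_pow_of_le (Nat.le_succ _)))).congr_left fun u => ?_
      simp only [map_add, hR', if_neg hi]
      abel

theorem mul_pow_smul_mem_tangentJets (hd : 2 ≤ d) (i : Fin N) {lam mu : E →L[ℂ] ℂ}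
    (hlam : Function.Injective fun i => lam (x i)) {v : E} (hv : lam v = 0) (hmu : mu v = 1) :
    (fun u => (lam u ^ (d - 1) * mu u) • v) ∈ tangentJets x hd i := by
  obtain ⟨m, rfl⟩ : ∃ m, d = m + 1 := ⟨d - 1, by omega⟩
  simp only [Nat.add_sub_cancel]
  intro c hc
  obtain ⟨P, ⟨R, hR⟩, hP⟩ := exists_polynomial_leading hlam i m
  have hone : (fun _ => v) =O[𝓝 (0 : E)] fun _ => (1 : ℝ) :=
    isBigO_const_const v one_ne_zero _
  have hO : (fun u => (lam u ^ m * mu u) • v) =O[𝓝 0] fun u => ‖u‖ ^ (m + 1) := by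
    simpa [pow_succ] using (((isBigO_continuousLinearMap_norm lam).pow m).mul
      (isBigO_continuousLinearMap_norm mu)).smul hone
  refine ⟨fun i' w hw => ?_, _, _,
    IsAutFamily.overshear (η := fun q => c q.1 * P.eval (lam q.2)) (fun w z hw => ?_)
      (fun w z t hw => ?_) mu hmu (x i), fun i' w hw => ?_⟩
  · split_ifs
    · exact hO.const_smul_left _
    · exact isBigO_zero _ _
  · refine AnalyticAt.mul ?_ ?_
    · exact (analyticAt_of_punctured hc hw).fun_comp_of_eq analyticAt_fst rfl
    · exact (AnalyticAt.aeval_polynomial analyticAt_id P).fun_comp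
        ((lam.analyticAt _).fun_comp analyticAt_snd)
  · simp [hv]
  · by_cases hi : i' = i
    · subst hi
      have h1 : (fun u => c w * P.eval (lam (x i' + u)) - c w * lam u ^ m) =O[𝓝 0]
          fun u => ‖u‖ ^ (m + 1) := by
        refine ((isBigO_pow_mul_eval lam (m + 1) R).const_mul_left (c w)).congr_left fun u => ?_
        rw [map_add, hR]
        ring
      have h2 : (fun u => c w * P.eval (lam (x i' + u))) =O[𝓝 0] fun u => ‖u‖ ^ m := by
        simpa using (h1.trans (isBigO_norm_pow_of_le m.le_succ)).add
          (((isBigO_continuousLinearMap_norm lam).pow m).const_mul_left (c w))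
      have h3 := (isBigO_exp_sub_one (by omega) h2).2.add h1
      have h4 : (fun u => ((Complex.exp (c w * P.eval (lam (x i' + u))) - 1 -
          c w * lam u ^ m) * mu u) • v) =O[𝓝 0] fun u => ‖u‖ ^ (m + 1 + 1) := by
        simpa [pow_succ] using (h3.mul (isBigO_continuousLinearMap_norm mu)).smul hone
      refine h4.congr_left fun u => ?_
      simp only [if_true, add_sub_cancel_left, sub_mul, sub_smul, smul_smul, mul_assoc]
      abel
    · obtain ⟨R', hR'⟩ := hP i' hi
      have h1 : (fun u => c w * P.eval (lam (x i' + u))) =O[𝓝 0] fun u => ‖u‖ ^ (m + 2) := by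
        refine ((isBigO_pow_mul_eval lam (m + 2) R').const_mul_left (c w)).congr_left fun u => ?_
        rw [map_add, hR']
      have h2 : (fun u => mu (x i' + u - x i)) =O[𝓝 0] fun _ => (1 : ℝ) :=
        ((by fun_prop : Continuous fun u => mu (x i' + u - x i)).tendsto (0 : E)).isBigO_one ℝ
      have h3 : (fun u => ((Complex.exp (c w * P.eval (lam (x i' + u))) - 1) *
          mu (x i' + u - x i)) • v) =O[𝓝 0] fun u => ‖u‖ ^ (m + 1 + 1) := by
        simpa using ((isBigO_exp_sub_one (by omega) h1).1.mul h2).smul hone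
      refine h3.congr_left fun u => ?_
      simp only [if_neg hi]
      abel

end JetInterpolation

namespace JetInterpolation
open Filter Topology Set Polynomial

section

variable {α V : Type*} [AddCommGroup V] [Module ℂ V]

/-- If a polynomial curve lies in a subspace for infinitely many parameters, then so do its
coefficients. -/
theorem mem_of_infinite_sum_pow_smul_mem (S : Submodule ℂ V) (C : ℕ → V) {D : ℕ}
    (h : {t : ℂ | ∑ k ∈ Finset.range D, t ^ k • C k ∈ S}.Infinite) {k : ℕ} (hk : k < D) :
    C k ∈ S := by
  by_contra hmem
  obtain ⟨φ, hφ, hS⟩ := Submodule.exists_le_ker_of_notMem hmem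
  let p : ℂ[X] := ∑ k ∈ Finset.range D, Polynomial.C (φ (C k)) * X ^ k
  have hp : p = 0 := by
    refine eq_zero_of_infinite_isRoot p (h.mono fun t ht => ?_)
    have h0 : φ (∑ k ∈ Finset.range D, t ^ k • C k) = 0 := hS ht
    simp only [map_sum, map_smul, smul_eq_mul] at h0
    simpa only [mem_ofPred_eq, IsRoot, p, eval_finsetSum, eval_mul, eval_C, eval_pow, eval_X, mul_comm] using h0
  have hc : p.coeff k = φ (C k) := by
    simp [p, finsetSum_coeff, coeff_C_mul, coeff_X_pow, hk]
  rw [hp, coeff_zero] at hc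
  exact hφ hc.symm

theorem coeff_smul_mem_of_infinite (S : Submodule ℂ (α → V)) {p q : α → ℂ[X]} {v v' : V} {D : ℕ}
    (hp : ∀ u, (p u).natDegree < D) (hq : ∀ u, (q u).natDegree < D)
    (h : {t : ℂ | (fun u => (p u).eval t • v + (q u).eval t • v') ∈ S}.Infinite) {k : ℕ}
    (hk : k < D) : (fun u => (p u).coeff k • v + (q u).coeff k • v') ∈ S := by
  refine mem_of_infinite_sum_pow_smul_mem S
    (fun k u => (p u).coeff k • v + (q u).coeff k • v') (D := D) (h.mono fun t ht => ?_) hk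
  have : ∑ k ∈ Finset.range D, t ^ k • (fun u => (p u).coeff k • v + (q u).coeff k • v') =
      fun u => (p u).eval t • v + (q u).eval t • v' := by
    ext u
    simp only [Finset.sum_apply, Pi.smul_apply, smul_add, smul_smul, Finset.sum_add_distrib,
      ← Finset.sum_smul, eval_eq_sum_range' (hp u), eval_eq_sum_range' (hq u), mul_comm]
  simpa only [mem_ofPred_eq, this] using ht

theorem natDegree_linear_pow_le (a c : ℂ) (d : ℕ) :
    ((Polynomial.C a + Polynomial.C c * X) ^ d).natDegree ≤ d := by
  compute_degree

theorem coeff_zero_linear_pow (a c : ℂ) (d : ℕ) :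
    ((Polynomial.C a + Polynomial.C c * X) ^ d).coeff 0 = a ^ d := by
  simp [coeff_zero_eq_eval_zero]

theorem coeff_one_linear_pow (a c : ℂ) (d : ℕ) :
    ((Polynomial.C a + Polynomial.C c * X) ^ d).coeff 1 = d * a ^ (d - 1) * c := by
  have h := coeff_derivative ((Polynomial.C a + Polynomial.C c * X) ^ d) 0
  rw [Nat.cast_zero, zero_add, zero_add, mul_one] at h
  rw [← h, coeff_zero_eq_eval_zero]
  simp [derivative_pow]

end

variable {E : Type*} [NormedAddCommGroup E] [NormedSpace ℂ E] {N d : ℕ} {x : Fin N → E}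

theorem infinite_setOf_injective_add_smul {lam mu : E →L[ℂ] ℂ}
    (h : ∀ i i', i ≠ i' → lam (x i) ≠ lam (x i') ∨ mu (x i) ≠ mu (x i')) :
    {t : ℂ | Function.Injective fun i => (lam + t • mu) (x i)}.Infinite := by
  have hfin : (⋃ p : Fin N × Fin N, {t : ℂ | p.1 ≠ p.2 ∧
      lam (x p.1) + t * mu (x p.1) = lam (x p.2) + t * mu (x p.2)}).Finite := by
    refine finite_iUnion fun p => Set.Subsingleton.finite ?_
    rintro t ⟨hp, ht⟩ s ⟨-, hs⟩
    have h1 : (t - s) * (mu (x p.1) - mu (x p.2)) = 0 := by linear_combination ht - hs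
    rcases mul_eq_zero.1 h1 with h1 | h1
    · exact sub_eq_zero.1 h1
    · have h2 := sub_eq_zero.1 h1
      rw [h2] at ht
      exact absurd (add_right_cancel ht) ((h _ _ hp).resolve_right (not_not.2 h2))
  refine hfin.infinite_compl.mono fun t ht i i' hii' => ?_
  by_contra hne
  exact ht (mem_iUnion.2 ⟨(i, i'), hne, by simpa using hii'⟩)

theorem pow_smul_mem_tangentJets_of_injective [FiniteDimensional ℂ E]
    (hE : 2 ≤ Module.finrank ℂ E) (hd : 2 ≤ d) (i : Fin N) {lam : E →L[ℂ] ℂ}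
    (hlam : Function.Injective fun i => lam (x i)) (v : E) :
    (fun u => lam u ^ d • v) ∈ tangentJets x hd i := by
  by_cases hv : lam v = 0
  · exact pow_smul_mem_tangentJets hd i hlam hv
  suffices H : ∀ v, lam v = 1 → (fun u => lam u ^ d • v) ∈ tangentJets x hd i by
    have := (tangentJets x hd i).smul_mem (lam v) (H ((lam v)⁻¹ • v) (by simp [hv]))
    convert this using 2 with u
    simp [smul_comm (lam v), hv]
  intro v hv
  obtain ⟨v', hv', hne⟩ := Submodule.exists_mem_ne_zero_of_ne_bot
    (LinearMap.ker_ne_bot_of_finrank_lt (f := (lam : E →ₗ[ℂ] ℂ)) (by simp; omega))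
  replace hv' : lam v' = 0 := hv'
  obtain ⟨mu₀, hmu₀⟩ := SeparatingDual.exists_eq_one (R := ℂ) hne
  let mu : E →L[ℂ] ℂ := mu₀ - mu₀ v • lam
  have hmu' : mu v' = 1 := by simp [mu, hmu₀, hv']
  have hmu : mu v = 0 := by simp [mu, hv]
  have hinf := infinite_setOf_injective_add_smul (lam := lam) (mu := mu) (x := x)
    fun j j' hj => Or.inl (hlam.ne hj)
  have hcoeff := coeff_smul_mem_of_infinite (tangentJets x hd i)
    (p := fun u => X * (Polynomial.C (lam u) + Polynomial.C (mu u) * X) ^ d)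
    (q := fun u => -(Polynomial.C (lam u) + Polynomial.C (mu u) * X) ^ d) (v := v) (v' := v')
    (D := d + 2) (k := 1)
    (fun u => (natDegree_mul_le.trans
      (add_le_add natDegree_X_le (natDegree_linear_pow_le _ _ d))).trans_lt (by omega))
    (fun u => by
      rw [natDegree_neg]
      exact (natDegree_linear_pow_le _ _ d).trans_lt (by omega))
    (hinf.mono fun t ht => by
      have := pow_smul_mem_tangentJets hd i ht (v := t • v - v') (by simp [hv, hv', hmu, hmu'])
      simp only [mem_ofPred_eq]
      convert this using 2 with u
      simp only [eval_mul, eval_X, eval_pow, eval_add, eval_C, eval_neg, smul_sub, smul_smul,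
        add_apply, smul_apply, smul_eq_mul, neg_smul,
        mul_comm t, ← sub_eq_add_neg]) (by omega)
  have hover := (tangentJets x hd i).smul_mem (d : ℂ)
    (mul_pow_smul_mem_tangentJets hd i hlam hv' hmu')
  convert (tangentJets x hd i).add_mem hcoeff hover using 2 with u
  simp only [coeff_X_mul, coeff_neg, coeff_one_linear_pow, coeff_zero_linear_pow, smul_smul,
    Pi.add_apply, Pi.smul_apply, neg_smul, mul_assoc, neg_add_cancel_right]

theorem pow_smul_mem_tangentJets_of_separating [FiniteDimensional ℂ E]
    (hE : 2 ≤ Module.finrank ℂ E) (hd : 2 ≤ d) (i : Fin N) {lam₀ : E →L[ℂ] ℂ}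
    (hlam₀ : Function.Injective fun i => lam₀ (x i)) (lam : E →L[ℂ] ℂ) (v : E) :
    (fun u => lam u ^ d • v) ∈ tangentJets x hd i := by
  have hinf := infinite_setOf_injective_add_smul (lam := lam) (mu := lam₀) (x := x)
    fun j j' hj => Or.inr (hlam₀.ne hj)
  have hcoeff := coeff_smul_mem_of_infinite (tangentJets x hd i)
    (p := fun u => (Polynomial.C (lam u) + Polynomial.C (lam₀ u) * X) ^ d)
    (q := fun u => 0) (v := v) (v' := 0) (D := d + 1) (k := 0)
    (fun u => (natDegree_linear_pow_le _ _ d).trans_lt (by omega)) (fun u => by simp)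
    (hinf.mono fun t ht => by
      simpa [mul_comm t] using pow_smul_mem_tangentJets_of_injective hE hd i ht v) (by omega)
  simpa [coeff_zero_linear_pow] using hcoeff

theorem list_prod_mul_pow_smul_mem_tangentJets [FiniteDimensional ℂ E]
    (hE : 2 ≤ Module.finrank ℂ E) (hd : 2 ≤ d) (i : Fin N) {lam₀ : E →L[ℂ] ℂ}
    (hlam₀ : Function.Injective fun i => lam₀ (x i)) (v : E) (L : List (E →L[ℂ] ℂ)) :
    ∀ (e : ℕ) (lam : E →L[ℂ] ℂ), L.length + e = d →
      (fun u => ((L.map fun l => l u).prod * lam u ^ e) • v) ∈ tangentJets x hd i := by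
  induction L with
  | nil =>
    rintro e lam rfl
    simpa using pow_smul_mem_tangentJets_of_separating hE (by simpa using hd) i hlam₀ lam v
  | cons l L ih =>
    intro e lam he
    have hcoeff := coeff_smul_mem_of_infinite (tangentJets x hd i)
      (p := fun u => Polynomial.C (L.map fun l => l u).prod *
        (Polynomial.C (lam u) + Polynomial.C (l u) * X) ^ (e + 1))
      (q := fun u => 0) (v := v) (v' := 0) (D := e + 2) (k := 1)
      (fun u => ((natDegree_C_mul_le _ _).trans
        (natDegree_linear_pow_le _ _ (e + 1))).trans_lt (by omega)) (fun u => by simp)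
      ((infinite_univ (α := ℂ)).mono fun t _ => by
        simpa [mul_comm t] using ih (e + 1) (lam + t • l) (by simp at he; omega)) (by omega)
    have he0 : ((e : ℂ) + 1) ≠ 0 := by exact_mod_cast Nat.succ_ne_zero e
    convert (tangentJets x hd i).smul_mem ((e : ℂ) + 1)⁻¹ hcoeff using 2 with u
    simp only [coeff_C_mul, coeff_one_linear_pow, List.map_cons, List.prod_cons, coeff_zero,
      zero_smul, add_zero, Pi.smul_apply, smul_smul]
    congr 1
    push_cast
    field_simp

theorem isTangentJet_multilinear [FiniteDimensional ℂ E] {n : ℕ} (b : Module.Basis (Fin n) ℂ E)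
    (hn : 2 ≤ n) (hd : 2 ≤ d) {lam₀ : E →L[ℂ] ℂ}
    (hlam₀ : Function.Injective fun i => lam₀ (x i)) {T : Fin N → ℂ → E [×d]→L[ℂ] E}
    (hT : ∀ i v, DifferentiableOn ℂ (fun w => T i w v) {0}ᶜ) :
    IsTangentJet x d fun i w u => T i w fun _ => u := by
  have hE : 2 ≤ Module.finrank ℂ E := by
    rw [Module.finrank_eq_card_basis b, Fintype.card_fin]
    exact hn
  have hmem : ∀ i (I : Fin d → Fin n) a,
      (fun u => (∏ k, coordL b (I k) u) • b a) ∈ tangentJets x hd i := fun i I a => by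
    have := list_prod_mul_pow_smul_mem_tangentJets hE hd i hlam₀ (b a)
      (List.ofFn fun k => coordL b (I k)) 0 0 (by simp)
    simpa [List.map_ofFn, Function.comp_def, List.prod_ofFn] using this
  have hsum : IsTangentJet x d fun i' w u => ∑ i, ∑ I : Fin d → Fin n, ∑ a,
      if i' = i then coordL b a (T i w fun k => b (I k)) •
        (∏ k, coordL b (I k) u) • b a else 0 :=
    IsTangentJet.sum hd _ fun i _ => IsTangentJet.sum hd _ fun I _ =>
      IsTangentJet.sum hd _ fun a _ => hmem i I a (fun w => coordL b a (T i w fun k => b (I k)))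
        ((coordL b a).differentiable.comp_differentiableOn (hT i _))
  refine hsum.congr fun i' w _ => ?_
  ext u
  have hu : (T i' w fun _ => u) = ∑ I : Fin d → Fin n, (∏ k, coordL b (I k) u) •
      T i' w fun k => b (I k) := by
    conv_lhs => rw [← sum_coordL_smul b u]
    rw [ContinuousMultilinearMap.map_sum]
    exact Finset.sum_congr rfl fun I _ =>
      (T i' w).map_smul_univ (fun k => coordL b (I k) u) (fun k => b (I k))
  rw [hu, Finset.sum_eq_single i' (fun i _ hi => by simp [hi.symm]) (by simp)]
  refine Finset.sum_congr rfl fun I _ => ?_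
  conv_rhs => rw [← sum_coordL_smul b (T i' w fun k => b (I k)), Finset.smul_sum]
  exact Finset.sum_congr rfl fun a _ => by rw [if_pos rfl, smul_comm]

end JetInterpolation

namespace JetInterpolation
open Filter Topology Set Asymptotics

variable {E : Type*} [NormedAddCommGroup E] [NormedSpace ℂ E] [FiniteDimensional ℂ E] {n N d : ℕ}
  {x : Fin N → E}

/-- The derivatives of degree `d` at finitely many points can be prescribed without changing those
of lower degree. -/
theorem IsAutFamily.exists_adjust {F G : ℂ × E → E} (hF : IsAutFamily F G)
    (b : Module.Basis (Fin n) ℂ E) (hn : 2 ≤ n) (hd : 2 ≤ d) {lam₀ : E →L[ℂ] ℂ}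
    (hlam₀ : Function.Injective fun i => lam₀ (x i)) {B : Fin N → ℂ → E [×d]→L[ℂ] E}
    (hB : ∀ i v, DifferentiableOn ℂ (fun w => B i w v) {0}ᶜ)
    (hsymm : ∀ i w, w ≠ 0 → ∀ (σ : Equiv.Perm (Fin d)) v, B i w (v ∘ σ) = B i w v) :
    ∃ F' G', IsAutFamily F' G' ∧ ∀ w, w ≠ 0 → ∀ i,
      (∀ j < d, iteratedFDeriv ℂ j (fun z => F' (w, z)) (x i) =
        iteratedFDeriv ℂ j (fun z => F (w, z)) (x i)) ∧
      iteratedFDeriv ℂ d (fun z => F' (w, z)) (x i) = B i w := by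
  have : CompleteSpace E := FiniteDimensional.complete ℂ E
  let δ : Fin N → ℂ → E [×d]→L[ℂ] E := fun i w =>
    (d.factorial : ℂ)⁻¹ • (B i w - iteratedFDeriv ℂ d (fun z => F (w, z)) (x i))
  have hδ : ∀ i w, w ≠ 0 → ∀ (σ : Equiv.Perm (Fin d)) v, δ i w (v ∘ σ) = δ i w v := by
    intro i w hw σ v
    simp only [δ, smul_apply, sub_apply,
      hsymm i w hw]
    rw [(hF.analyticAt_slice hw (x i)).contDiffAt.iteratedFDeriv_comp_perm]
  let T : Fin N → ℂ → E [×d]→L[ℂ] E := fun i w =>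
    (fderiv ℂ (fun z => G (w, z)) (F (w, x i))).compContinuousMultilinearMap (δ i w)
  have hT : ∀ i v, DifferentiableOn ℂ (fun w => T i w v) {0}ᶜ := by
    refine fun i v w hw => DifferentiableAt.differentiableWithinAt ?_
    have hx : AnalyticAt ℂ (fun w => (w, x i)) w := analyticAt_id.prod analyticAt_const
    have h1 : AnalyticAt ℂ (fun w => fderiv ℂ (fun z => G (w, z)) (F (w, x i))) w :=
      AnalyticAt.fun_comp_of_eq
        (g := fun q : ℂ × E => fderiv ℂ (fun z => G (q.1, z)) q.2)
        (analyticAt_fderiv_slice hF.analyticAt_inv w (F (w, x i)) hw)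
        (analyticAt_id.prod ((hF.analyticAt w (x i) hw).fun_comp_of_eq hx rfl)) rfl
    have h2 : AnalyticAt ℂ (fun w => iteratedFDeriv ℂ d (fun z => F (w, z)) (x i)) w :=
      AnalyticAt.fun_comp_of_eq
        (g := fun q : ℂ × E => iteratedFDeriv ℂ d (fun z => F (q.1, z)) q.2)
        (analyticAt_iteratedFDeriv_slice hF.analyticAt d w (x i) hw) hx rfl
    have h3 : AnalyticAt ℂ (fun w => iteratedFDeriv ℂ d (fun z => F (w, z)) (x i) v) w :=
      ((ContinuousMultilinearMap.apply ℂ (fun _ : Fin d => E) E v).analyticAt _).fun_comp h2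
    exact h1.differentiableAt.clm_apply
      (((analyticAt_of_punctured (hB i v) hw).sub h3).differentiableAt.const_smul
        (d.factorial : ℂ)⁻¹)
  obtain ⟨hO, S, S', hS, hjet⟩ := isTangentJet_multilinear b hn hd hlam₀ hT
  refine ⟨_, _, hF.comp hS, fun w hw i => ?_⟩
  have hψ : (fun u => S (w, x i + u) - x i - u) =O[𝓝 0] fun u => ‖u‖ ^ d := by
    simpa using ((hjet i w hw).trans (isBigO_norm_pow_of_le d.le_succ)).add (hO i w hw)
  have hp := isBigO_comp_perturbation (hF.analyticAt_slice hw (x i))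
    (ψ := fun u => S (w, x i + u) - x i) (by omega) hψ
  have hrest : (fun u => F (w, S (w, x i + u)) - F (w, x i + u) - δ i w fun _ => u) =O[𝓝 0]
      fun u => ‖u‖ ^ (d + 1) := by
    refine (hp.add (((fderiv ℂ (fun z => F (w, z)) (x i)).isBigO_comp _ _).trans
      (hjet i w hw))).congr_left fun u => ?_
    have h := congrArg (fun R : E →L[ℂ] E => R (δ i w fun _ => u)) (hF.fderiv_comp_inv hw (x i))
    simp only [ContinuousLinearMap.comp_apply, ContinuousLinearMap.id_apply] at h
    simp only [add_sub_cancel, map_sub, T,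
      ContinuousLinearMap.compContinuousMultilinearMap_coe, Function.comp_apply, h]
    abel
  have ha : ∀ {Φ : ℂ × E → E}, (∀ w z, w ≠ 0 → AnalyticAt ℂ Φ (w, z)) →
      AnalyticAt ℂ (fun u => Φ (w, x i + u)) 0 := fun {Φ} hΦ =>
    (JetInterpolation.analyticAt_slice (hΦ w (x i) hw)).fun_comp_of_eq (analyticAt_const.add analyticAt_id)
      (by simp)
  have haF := ha hF.analyticAt
  have haF' : AnalyticAt ℂ (fun u => F (w, S (w, x i + u))) 0 := ha (hF.comp hS).analyticAt
  have haδ : AnalyticAt ℂ (fun u => δ i w fun _ => u) 0 :=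
    (δ i w).analyticAt.fun_comp (AnalyticAt.pi fun _ => analyticAt_id)
  have hzero : ∀ j ≤ d, iteratedFDeriv ℂ j (fun z => F (w, S (w, z))) (x i) =
      iteratedFDeriv ℂ j (fun z => F (w, z)) (x i) +
        iteratedFDeriv ℂ j (fun u => δ i w fun _ => u) 0 := by
    intro j hj
    have h := iteratedFDeriv_eq_zero_of_isBigO ((haF'.sub haF).sub haδ) hrest hj
    rw [iteratedFDeriv_sub_apply (haF'.sub haF).contDiffAt haδ.contDiffAt,
      iteratedFDeriv_sub_apply haF'.contDiffAt haF.contDiffAt,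
      iteratedFDeriv_comp_add_left (f := fun z => F (w, S (w, z))),
      iteratedFDeriv_comp_add_left (f := fun z => F (w, z)), add_zero] at h
    rw [← sub_eq_zero, ← h]
    abel
  refine ⟨fun j hj => ?_, ?_⟩
  · have h0 : iteratedFDeriv ℂ j (fun u => δ i w fun _ => u) 0 = 0 :=
      iteratedFDeriv_eq_zero_of_isBigO (d := d - 1) haδ
        (by rw [Nat.sub_add_cancel (by omega)]; exact isBigO_diagonal _) (by omega)
    rw [hzero j hj.le, h0, add_zero]
  · have hfac : (d.factorial : ℂ) ≠ 0 := by exact_mod_cast d.factorial_ne_zero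
    rw [hzero d le_rfl, iteratedFDeriv_diagonal_of_symm _ (hδ i w hw), smul_inv_smul₀ hfac]
    abel

theorem differentiableOn_matrix_det {M : ℂ → Matrix (Fin n) (Fin n) ℂ} {s : Set ℂ}
    (hM : ∀ k l, DifferentiableOn ℂ (fun w => M w k l) s) :
    DifferentiableOn ℂ (fun w => (M w).det) s := by
  simp only [Matrix.det_apply]
  exact DifferentiableOn.fun_sum fun σ _ =>
    (DifferentiableOn.fun_finsetProd fun k _ => hM _ _).const_smul _

theorem differentiableOn_toMatrix (b : Module.Basis (Fin n) ℂ E) {L : ℂ → E →L[ℂ] E} {s : Set ℂ}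
    (hL : ∀ v, DifferentiableOn ℂ (fun w => L w v) s) (k l : Fin n) :
    DifferentiableOn ℂ (fun w => LinearMap.toMatrix b b (L w : E →ₗ[ℂ] E) k l) s := by
  have : ∀ w, LinearMap.toMatrix b b (L w : E →ₗ[ℂ] E) k l = coordL b k (L w (b l)) := fun w => by
    simp [LinearMap.toMatrix_apply, coordL]
  simp only [this]
  exact (coordL b k).differentiable.comp_differentiableOn (hL _)

/-- Interpolation of values and first derivatives. -/
theorem exists_autFamily_fderiv_eq (b : Module.Basis (Fin n) ℂ E) (hn : 2 ≤ n)
    (hx : ∀ j, Function.Injective fun i => coordL b j (x i)) {y : Fin N → ℂ → E}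
    (hy : ∀ i, DifferentiableOn ℂ (y i) {0}ᶜ)
    (hyne : ∀ w, w ≠ 0 → ∀ i i', i ≠ i' → y i w ≠ y i' w) {L : Fin N → ℂ → E →L[ℂ] E}
    (hL : ∀ i v, DifferentiableOn ℂ (fun w => L i w v) {0}ᶜ) {g : Fin N → ℂ → ℂ}
    (hg : ∀ i, DifferentiableOn ℂ (g i) {0}ᶜ)
    (hdet : ∀ i w, w ≠ 0 → (L i w).det = Complex.exp (g i w)) :
    ∃ F G, IsAutFamily F G ∧ ∀ w, w ≠ 0 → ∀ i, F (w, x i) = y i w ∧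
      fderiv ℂ (fun z => F (w, z)) (x i) = L i w := by
  have : CompleteSpace E := FiniteDimensional.complete ℂ E
  have hya : ∀ i w, w ≠ 0 → AnalyticAt ℂ (y i) w := fun i w hw => analyticAt_of_punctured (hy i) hw
  obtain ⟨F, G, hF, hFx⟩ := exists_volFamily_move b
    (show (⟨0, by omega⟩ : Fin n) ≠ ⟨1, by omega⟩ by simp) x (hx _) hya hyne
  let R : Fin N → ℂ → E →L[ℂ] E := fun i w =>
    (fderiv ℂ (fun z => G (w, z)) (y i w)).comp (L i w)
  have hR : ∀ i v, DifferentiableOn ℂ (fun w => R i w v) {0}ᶜ := by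
    refine fun i v w hw => DifferentiableAt.differentiableWithinAt ?_
    have h1 : AnalyticAt ℂ (fun w => fderiv ℂ (fun z => G (w, z)) (y i w)) w :=
      AnalyticAt.fun_comp_of_eq
        (g := fun q : ℂ × E => fderiv ℂ (fun z => G (q.1, z)) q.2)
        (analyticAt_fderiv_slice hF.analyticAt_inv w (y i w) hw)
        (analyticAt_id.prod (hya i w hw)) rfl
    exact h1.differentiableAt.clm_apply (analyticAt_of_punctured (hL i v) hw).differentiableAt
  obtain ⟨S, S', hS, hSx⟩ := exists_autFamily_fderiv hn hx
    (M := fun i w => LinearMap.toMatrix b b (R i w : E →ₗ[ℂ] E))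
    (fun i => differentiableOn_toMatrix b (hR i)) hg (fun i w hw => by
      rw [LinearMap.det_toMatrix, ← hdet i w hw, ← one_mul (L i w).det,
        ← hF.symm.det_fderiv w (y i w) hw]
      exact LinearMap.det_comp _ _)
  refine ⟨_, _, hF.toIsAutFamily.comp hS, fun w hw i => ?_⟩
  obtain ⟨hval, hder⟩ := hSx w hw i
  refine ⟨by simp only [hval, hFx w hw i], ?_⟩
  rw [Matrix.toLin_toMatrix] at hder
  rw [hF.toIsAutFamily.fderiv_comp hS hw, hval, ContinuousLinearMap.coe_injective hder]
  simp only [R]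
  rw [← ContinuousLinearMap.comp_assoc, ← hFx w hw i, hF.toIsAutFamily.fderiv_comp_inv hw,
    ContinuousLinearMap.id_comp]

/-- A basis all of whose coordinate functionals separate finitely many given points. -/
theorem exists_basis_injective_coordL {x : Fin N → EuclideanSpace ℂ (Fin n)}
    (hx : Function.Injective x) : ∃ b : Module.Basis (Fin n) ℂ (EuclideanSpace ℂ (Fin n)),
      ∀ j, Function.Injective fun i => coordL b j (x i) := by
  let p : Fin N × Fin N → Polynomial ℂ := fun q =>
    ∑ c : Fin n, Polynomial.C (x q.1 c - x q.2 c) * Polynomial.X ^ (c : ℕ)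
  have hp : ∀ q : Fin N × Fin N, q.1 ≠ q.2 → p q ≠ 0 := by
    intro q hq h0
    refine hq (hx ?_)
    ext c
    have h1 : (p q).coeff c = x q.1 c - x q.2 c := by
      simp only [p, Polynomial.finsetSum_coeff, Polynomial.coeff_C_mul, Polynomial.coeff_X_pow,
        Fin.val_inj]
      simp
    rw [h0, Polynomial.coeff_zero] at h1
    exact (sub_eq_zero.1 h1.symm)
  have hfin : (⋃ q : Fin N × Fin N, {s : ℂ | q.1 ≠ q.2 ∧ (p q).IsRoot s}).Finite := by
    refine finite_iUnion fun q => ?_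
    by_cases hq : q.1 = q.2
    · simp [hq]
    · exact (Polynomial.finite_setOfPred_isRoot (hp q hq)).subset fun s hs => hs.2
  let s : Fin n → ℂ := fun a => hfin.infinite_compl.natEmbedding _ a
  have hs : Function.Injective s := fun a a' h =>
    Fin.ext ((hfin.infinite_compl.natEmbedding _).injective (Subtype.ext h))
  have hV : Function.Injective (Matrix.toLin' (Matrix.vandermonde s)) := by
    rw [Matrix.toLin'_apply', Matrix.coe_mulVecLin, Matrix.mulVec_injective_iff_isUnit,
      Matrix.isUnit_iff_isUnit_det]
    exact (Matrix.det_vandermonde_ne_zero_iff.2 hs).isUnit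
  let e : EuclideanSpace ℂ (Fin n) ≃ₗ[ℂ] (Fin n → ℂ) :=
    (WithLp.linearEquiv 2 ℂ (Fin n → ℂ)).trans (LinearEquiv.ofInjectiveEndo _ hV)
  refine ⟨Module.Basis.ofEquivFun e, fun j i i' h => ?_⟩
  have hc : ∀ z, coordL (Module.Basis.ofEquivFun e) j z = ∑ c : Fin n, s j ^ (c : ℕ) * z c :=
    fun z => by
      simp [coordL, e, Matrix.mulVec, dotProduct, Matrix.vandermonde_apply]
  simp only [hc] at h
  by_contra hne
  refine (hfin.infinite_compl.natEmbedding _ j).2 (mem_iUnion.2 ⟨(i, i'), hne, ?_⟩)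
  change (p (i, i')).eval (s j) = 0
  simp only [p, Polynomial.eval_finsetSum, Polynomial.eval_mul,
    Polynomial.eval_C, Polynomial.eval_pow, Polynomial.eval_X, sub_mul, Finset.sum_sub_distrib]
  rw [sub_eq_zero]
  simpa only [mul_comm] using h

end JetInterpolation

namespace JetInterpolation
open Filter Topology Set

section

variable {E : Type*} [NormedAddCommGroup E] [NormedSpace ℂ E]

/-- The linear map underlying a multilinear map of degree one. -/
noncomputable def linearPart : (E [×1]→L[ℂ] E) →L[ℂ] E →L[ℂ] E :=
  (continuousMultilinearCurryFin1 ℂ E E).toContinuousLinearEquiv.toContinuousLinearMap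

theorem linearPart_apply (f : E [×1]→L[ℂ] E) (v : E) : linearPart f v = f fun _ => v := by
  change f (Fin.snoc 0 v) = _
  congr 1

theorem iteratedFDeriv_one_eq_of_fderiv {Φ : E → E} {z : E} {f : E [×1]→L[ℂ] E}
    (h : fderiv ℂ Φ z = linearPart f) : iteratedFDeriv ℂ 1 Φ z = f := by
  ext v
  rw [iteratedFDeriv_one_apply, h, linearPart_apply]
  congr 1
  ext k
  rw [Subsingleton.elim k 0]

variable [FiniteDimensional ℂ E] {n k N : ℕ} {x : Fin N → E}

/-- Interpolation of jets whose linear parts have a holomorphic logarithm of the determinant. -/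
theorem exists_autFamily_jets (b : Module.Basis (Fin n) ℂ E) (hn : 2 ≤ n) (hk : 1 ≤ k)
    (hx : ∀ j, Function.Injective fun i => coordL b j (x i)) {y : Fin N → ℂ → E}
    (hy : ∀ i, DifferentiableOn ℂ (y i) {0}ᶜ)
    (hyne : ∀ w, w ≠ 0 → ∀ i i', i ≠ i' → y i w ≠ y i' w)
    {A : Fin N → (j : Fin k) → ℂ → E [×(j.1 + 1)]→L[ℂ] E}
    (hA : ∀ i j v, DifferentiableOn ℂ (fun w => A i j w v) {0}ᶜ)
    (hsymm : ∀ i (j : Fin k) w, w ≠ 0 → ∀ (σ : Equiv.Perm (Fin (j.1 + 1))) v,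
      A i j w (v ∘ σ) = A i j w v) {g : Fin N → ℂ → ℂ}
    (hg : ∀ i, DifferentiableOn ℂ (g i) {0}ᶜ)
    (hdet : ∀ i w, w ≠ 0 → (linearPart (A i ⟨0, hk⟩ w)).det = Complex.exp (g i w)) :
    ∃ F G, IsAutFamily F G ∧ ∀ w, w ≠ 0 → ∀ i, F (w, x i) = y i w ∧
      ∀ j : Fin k, iteratedFDeriv ℂ (j.1 + 1) (fun z => F (w, z)) (x i) = A i j w := by
  have key : ∀ m, 1 ≤ m → m ≤ k → ∃ F G, IsAutFamily F G ∧ ∀ w, w ≠ 0 → ∀ i, F (w, x i) = y i w ∧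
      ∀ j : Fin k, j.1 < m →
        iteratedFDeriv ℂ (j.1 + 1) (fun z => F (w, z)) (x i) = A i j w := by
    intro m hm
    induction m, hm using Nat.le_induction with
    | base =>
      intro _
      obtain ⟨F, G, hF, h⟩ := exists_autFamily_fderiv_eq b hn hx hy hyne
        (L := fun i w => linearPart (A i ⟨0, hk⟩ w))
        (fun i v => by simpa only [linearPart_apply] using hA i ⟨0, hk⟩ fun _ => v) hg hdet
      refine ⟨F, G, hF, fun w hw i => ⟨(h w hw i).1, fun j hj => ?_⟩⟩
      obtain rfl : j = ⟨0, hk⟩ := Fin.ext (Nat.lt_one_iff.1 hj)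
      exact iteratedFDeriv_one_eq_of_fderiv (h w hw i).2
    | succ m hm ih =>
      intro hmk
      obtain ⟨F, G, hF, h⟩ := ih (by omega)
      obtain ⟨F', G', hF', h'⟩ := hF.exists_adjust b hn (d := m + 1) (by omega)
        (hx ⟨0, by omega⟩) (hA · ⟨m, hmk⟩) (hsymm · ⟨m, hmk⟩)
      refine ⟨F', G', hF', fun w hw i => ⟨?_, fun j hj => ?_⟩⟩
      · have h0 := congrArg (fun f => f 0) ((h' w hw i).1 0 (by omega))
        simpa [(h w hw i).1] using h0
      · rcases Nat.lt_succ_iff_lt_or_eq.1 hj with hj | hj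
        · rw [(h' w hw i).1 _ (by omega), (h w hw i).2 j hj]
        · obtain rfl : j = ⟨m, hmk⟩ := Fin.ext hj
          exact (h' w hw i).2
  obtain ⟨F, G, hF, h⟩ := key k hk le_rfl
  exact ⟨F, G, hF, fun w hw i => ⟨(h w hw i).1, fun j => (h w hw i).2 j j.2⟩⟩

theorem differentiableOn_det (b : Module.Basis (Fin n) ℂ E) {L : ℂ → E →L[ℂ] E} {s : Set ℂ}
    (hL : ∀ v, DifferentiableOn ℂ (fun w => L w v) s) :
    DifferentiableOn ℂ (fun w => (L w).det) s :=
  (differentiableOn_matrix_det (differentiableOn_toMatrix b hL)).congr fun _ _ =>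
    (LinearMap.det_toMatrix b _).symm

end

theorem det_linearPart_ne_zero {n k N : ℕ} {p : JetTupleSpace n k N} (hp : p ∈ JetSet n k N)
    (hk : 1 ≤ k) (i : Fin N) : (linearPart (p.2 i ⟨0, hk⟩)).det ≠ 0 := by
  have hbij := hp.2.2 i ⟨0, hk⟩ rfl
  have h : Function.Bijective (linearPart (p.2 i ⟨0, hk⟩)) := by
    convert hbij using 1
    ext1 v
    exact linearPart_apply _ v
  exact (LinearEquiv.isUnit_det' (LinearEquiv.ofBijective
    (linearPart (p.2 i ⟨0, hk⟩) : EuclideanSpace ℂ (Fin n) →ₗ[ℂ] EuclideanSpace ℂ (Fin n))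
    h)).ne_zero

end JetInterpolation

/-- the `if` direction of the main theorem for `X = ℂⁿ` (n ≥ 2) and the Stein
parameter space `W = ℂ \ {0}`: a holomorphic family of nondegenerate `k`-jets which is
null-homotopic within `Y` is interpolated by a holomorphic family of holomorphic
automorphisms of `ℂⁿ`. Here `A i j w` encodes the derivative of degree `j.1 + 1`. -/
theorem parametric_jet_interpolation_punctured_plane
    (n k N : ℕ) (hn : 2 ≤ n) (hk : 1 ≤ k) (hN : 1 ≤ N)
    (xh : Fin N → EuclideanSpace ℂ (Fin n)) (hxh : Function.Injective xh)
    (y : Fin N → ℂ → EuclideanSpace ℂ (Fin n))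
    (A : Fin N → (j : Fin k) → ℂ → ContinuousMultilinearMap ℂ
      (fun _ : Fin (j.1 + 1) => EuclideanSpace ℂ (Fin n)) (EuclideanSpace ℂ (Fin n)))
    (hyholo : ∀ i, DifferentiableOn ℂ (y i) {0}ᶜ)
    (hAholo : ∀ i (j : Fin k) (v : Fin (j.1 + 1) → EuclideanSpace ℂ (Fin n)),
      DifferentiableOn ℂ (fun w => A i j w v) {0}ᶜ)
    (hγY : ∀ w : ℂ, w ≠ 0 →
      ((fun i => y i w, fun i j => A i j w) : JetTupleSpace n k N) ∈ JetSet n k N)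
    (hnull : ∃ H : unitInterval × {w : ℂ // w ≠ 0} → JetTupleSpace n k N,
      Continuous H ∧ (∀ t w, H (t, w) ∈ JetSet n k N) ∧
      (∀ w : {w : ℂ // w ≠ 0}, H (0, w) = (fun i => y i w.1, fun i j => A i j w.1)) ∧
      (∃ c, ∀ w, H (1, w) = c)) :
    ∃ F : ℂ × EuclideanSpace ℂ (Fin n) → EuclideanSpace ℂ (Fin n),
      DifferentiableOn ℂ F ({w : ℂ | w ≠ 0} ×ˢ (Set.univ : Set (EuclideanSpace ℂ (Fin n)))) ∧
      (∀ w : ℂ, w ≠ 0 →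
        (∃ G : EuclideanSpace ℂ (Fin n) → EuclideanSpace ℂ (Fin n),
          Differentiable ℂ G ∧ (∀ z, G (F (w, z)) = z) ∧ (∀ z, F (w, G z) = z)) ∧
        (∀ i, F (w, xh i) = y i w) ∧
        (∀ i (j : Fin k),
          iteratedFDeriv ℂ (j.1 + 1) (fun z => F (w, z)) (xh i) = A i j w)) := by
  open JetInterpolation in
  obtain ⟨H, hH, hHY, hH0, c, hc⟩ := hnull
  obtain ⟨b, hb⟩ := exists_basis_injective_coordL hxh
  have hlog : ∀ i, ∃ g : ℂ → ℂ, DifferentiableOn ℂ g {0}ᶜ ∧ ∀ w, w ≠ 0 →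
      (linearPart (A i ⟨0, hk⟩ w)).det = Complex.exp (g w) := by
    intro i
    refine exists_log_of_nullhomotopic
      (D := fun q => (linearPart ((H q).2 i ⟨0, hk⟩)).det)
      (c := (linearPart (c.2 i ⟨0, hk⟩)).det) ?_ (fun q => ?_) (fun w => ?_) ?_ (fun w => ?_)
    · have hcont : Continuous fun q => (H q).2 i ⟨0, hk⟩ :=
        (continuous_apply _).comp ((continuous_apply i).comp (continuous_snd.comp hH))
      exact ContinuousLinearMap.continuous_det.comp (linearPart.continuous.comp hcont)
    · exact det_linearPart_ne_zero (hHY q.1 q.2) hk i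
    · rw [hc w]
    · exact differentiableOn_det b fun v => by
        simpa only [linearPart_apply] using hAholo i ⟨0, hk⟩ fun _ => v
    · rw [hH0 w]
  choose g hg hdet using hlog
  obtain ⟨F, G, hF, h⟩ := exists_autFamily_jets b hn hk hb hyholo
    (fun w hw => (hγY w hw).1) hAholo (fun i j w hw => (hγY w hw).2.1 i j) hg hdet
  refine ⟨F, fun q hq => (hF.analyticAt q.1 q.2 hq.1).differentiableAt.differentiableWithinAt,
    fun w hw => ⟨⟨fun z => G (w, z),
      fun z => (hF.symm.analyticAt_slice hw z).differentiableAt,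
      fun z => hF.left_inv w z hw, fun z => hF.right_inv w z hw⟩,
      fun i => (h w hw i).1, fun i => (h w hw i).2⟩⟩
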